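/- For every 1 ≤ i ≤ σ, one has B_i = B̃_i^0 ∪ x_n·B_{i−1}; that is, the standard monomials of degree i are exactly the standard monomials of degree i not divisible by x_n together with x_n times the standard monomials of degree i−1. -/

import Mathlib

open MvPolynomial

/-- The total degree of an exponent vector. -/
def expDeg {n : ℕ} (μ : Fin n →₀ ℕ) : ℕ := μ.sum fun _ e => e

/-- Strict degree reverse lexicographic order on exponent vectors, for variables
`x_1 > ⋯ > x_n` (indexed by `Fin n` in this order). -/
def DrlLT {n : ℕ} (a b : Fin n →₀ ℕ) : Prop :=
  expDeg a < expDeg b ∨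
    (expDeg a = expDeg b ∧ ∃ i : Fin n, b i < a i ∧ ∀ j : Fin n, i < j → a j = b j)

/-- `μ` is the leading (degrevlex-largest) exponent of `p`. -/
def IsLeadExp {n : ℕ} {K : Type*} [CommSemiring K] (p : MvPolynomial (Fin n) K)
    (μ : Fin n →₀ ℕ) : Prop :=
  μ ∈ p.support ∧ ∀ ν ∈ p.support, ν ≠ μ → DrlLT ν μ

/-- The initial ideal of `I` with respect to the degree reverse lexicographic order. -/
noncomputable def initialIdeal {n : ℕ} {K : Type*} [CommRing K]
    (I : Ideal (MvPolynomial (Fin n) K)) : Ideal (MvPolynomial (Fin n) K) :=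
  Ideal.span { m | ∃ p ∈ I, p ≠ 0 ∧ ∃ μ, IsLeadExp p μ ∧ m = monomial μ (1 : K) }

/-- The standard monomials of degree `i` of `I` : exponents of the monomials of degree `i`
not lying in the initial ideal of `I`. -/
def stdMon {n : ℕ} {K : Type*} [CommRing K] (I : Ideal (MvPolynomial (Fin n) K)) (i : ℕ) :
    Set (Fin n →₀ ℕ) :=
  { μ | expDeg μ = i ∧ monomial μ (1 : K) ∉ initialIdeal I }

/-- `μ` is a minimal monomial generator of the monomial ideal `M`. -/
def IsMinGen {n : ℕ} {K : Type*} [CommRing K] (M : Ideal (MvPolynomial (Fin n) K))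
    (μ : Fin n →₀ ℕ) : Prop :=
  monomial μ (1 : K) ∈ M ∧ ∀ ν : Fin n →₀ ℕ, ν ≤ μ → ν ≠ μ → monomial ν (1 : K) ∉ M

/-- `μ` satisfies property `P` with respect to the monomial ideal `M`: if `m` is the largest
index of a variable dividing `x^μ`, then every monomial of the same degree in the variables of
index `< m` also lies in `M`. -/
def SatisfiesP {n : ℕ} {K : Type*} [CommRing K] (M : Ideal (MvPolynomial (Fin n) K))
    (μ : Fin n →₀ ℕ) : Prop :=
  ∀ m : Fin n, μ m ≠ 0 → (∀ j : Fin n, m < j → μ j = 0) →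
    ∀ ν : Fin n →₀ ℕ, expDeg ν = expDeg μ → (∀ j : Fin n, m ≤ j → ν j = 0) →
      monomial ν (1 : K) ∈ M

/-- Conjecture E (Pardue) holds for the ideal `I`: every minimal generator of the initial
ideal of `I` satisfies property `P`. -/
def ConjE {n : ℕ} {K : Type*} [CommRing K] (I : Ideal (MvPolynomial (Fin n) K)) : Prop :=
  ∀ μ, IsMinGen (initialIdeal I) μ → SatisfiesP (initialIdeal I) μ

/-- `f` is a generic sequence of forms of degrees `d i` over the base field `F`: each `f i` is
homogeneous of degree `d i` and the family of all coefficients (at all monomials of degree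
`d i`) is algebraically independent over `F`. -/
def IsGenericSeq (F : Type*) {K : Type*} [CommRing F] [CommRing K] [Algebra F K]
    {n r : ℕ} (d : Fin r → ℕ) (f : Fin r → MvPolynomial (Fin n) K) : Prop :=
  (∀ i, (f i).IsHomogeneous (d i)) ∧
    AlgebraicIndependent F
      (fun p : Σ i : Fin r, { μ : Fin n →₀ ℕ // expDeg μ = d i } => (f p.1).coeff p.2.1)

/-- The projection `K[x_1,…,x_n,z] → K[x_1,…,x_n]` sending `z` (the last variable) to `0` and
fixing the other variables. -/
noncomputable def projMap (K : Type*) [CommRing K] (n : ℕ) :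
    MvPolynomial (Fin (n + 1)) K →ₐ[K] MvPolynomial (Fin n) K :=
  aeval (fun i => Fin.lastCases 0 (fun j => X j) i)

/-- Embedding of exponent vectors of `K[x_1,…,x_n]` into those of `K[x_1,…,x_n,z]`
(`z`-exponent `0`). -/
noncomputable def embExp {n : ℕ} (μ : Fin n →₀ ℕ) : Fin (n + 1) →₀ ℕ :=
  Finsupp.embDomain ⟨Fin.castSucc, Fin.castSucc_injective n⟩ μ

/-- Multiplication by `z^c` on exponent vectors in `K[x_1,…,x_n,z]`. -/
noncomputable def zShift {n : ℕ} (c : ℕ) (μ : Fin (n + 1) →₀ ℕ) : Fin (n + 1) →₀ ℕ :=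
  μ + Finsupp.single (Fin.last n) c

/-- `f` (homogeneous of degree `e`) is semi-regular on `R/I`: in each degree `t`, the
multiplication map `(R/I)_t → (R/I)_{t+e}` is injective or surjective. -/
def SemiRegularOn {vars K : Type*} [CommRing K] (I : Ideal (MvPolynomial vars K))
    (f : MvPolynomial vars K) (e : ℕ) : Prop :=
  ∀ t : ℕ,
    (∀ p ∈ homogeneousSubmodule vars K t, f * p ∈ I → p ∈ I) ∨
    (∀ q ∈ homogeneousSubmodule vars K (t + e),
      ∃ p ∈ homogeneousSubmodule vars K t, q - f * p ∈ I)

/-- The degree-`t` graded piece of `R/I`, as a `K`-submodule of the quotient. -/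
noncomputable def quotDegPart {vars K : Type*} [CommRing K] (I : Ideal (MvPolynomial vars K))
    (t : ℕ) : Submodule K (MvPolynomial vars K ⧸ I) :=
  (homogeneousSubmodule vars K t).map (Ideal.Quotient.mkₐ K I).toLinearMap

section matrices

open scoped Matrix

theorem Matrix.exists_det_submatrix_ne_zero {m n K : Type*} [Field K] [Fintype m] [Fintype n]
    (M : Matrix m n K) :
    ∃ (r : Fin M.rank → m) (c : Fin M.rank → n), (M.submatrix r c).det ≠ 0 := by
  obtain ⟨κ, a, ha, hspan, hli⟩ := exists_linearIndependent' K M.row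
  have : Finite κ := Finite.of_injective a ha
  have := Fintype.ofFinite κ
  have hκ : Fintype.card κ = M.rank := by
    rw [Matrix.rank_eq_finrank_span_row, ← hspan, finrank_span_eq_card hli]
  have hr : (M.submatrix a id).rank = Fintype.card κ := LinearIndependent.rank_matrix hli
  obtain ⟨κ', b, hb, hspan', hli'⟩ := exists_linearIndependent' K (M.submatrix a id).col
  have : Finite κ' := Finite.of_injective b hb
  have := Fintype.ofFinite κ'
  have hκ' : Fintype.card κ' = M.rank := by
    rw [← hκ, ← hr, Matrix.rank_eq_finrank_span_cols, ← hspan', finrank_span_eq_card hli']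
  let e := (Fintype.equivFinOfCardEq hκ).symm
  let e' := (Fintype.equivFinOfCardEq hκ').symm
  refine ⟨a ∘ e, b ∘ e', ?_⟩
  have hu : IsUnit (M.submatrix (a ∘ e) (b ∘ e')) := by
    rw [← Matrix.linearIndependent_cols_iff_isUnit]
    have h1 := hli'.comp e' e'.injective
    have h2 := h1.map' (LinearEquiv.funCongrLeft K K e).toLinearMap (LinearEquiv.ker _)
    exact h2
  exact ((Matrix.isUnit_iff_isUnit_det _).1 hu).ne_zero

theorem Matrix.rank_map_le_rank_map {m n P L K : Type*} [CommRing P] [Field L] [Field K]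
    [Fintype m] [Fintype n] (M : Matrix m n P) (φ : P →+* L) (ψ : P →+* K)
    (hψ : Function.Injective ψ) : (M.map φ).rank ≤ (M.map ψ).rank := by
  obtain ⟨r, c, h⟩ := (M.map φ).exists_det_submatrix_ne_zero
  have h0 : (M.submatrix r c).det ≠ 0 := by
    intro h0
    apply h
    have := φ.map_det (M.submatrix r c)
    rw [h0, map_zero] at this
    exact this.symm
  have h1 : ((M.map ψ).submatrix r c).det ≠ 0 := by
    have := ψ.map_det (M.submatrix r c)
    intro h2
    exact h0 (hψ (by rw [map_zero, this]; exact h2))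
  have h2 := Matrix.rank_of_det_ne_zero h1
  calc _ = Fintype.card (Fin (M.map φ).rank) := (Fintype.card_fin _).symm
    _ = _ := h2.symm
    _ ≤ _ := Matrix.rank_submatrix_le _ _ _

theorem Matrix.exact_map_of_exact_map {l m n P L K : Type*} [CommRing P] [Field L] [Field K]
    [Fintype l] [Fintype m] [Fintype n] (A : Matrix l m P) (B : Matrix m n P) (hAB : A * B = 0)
    (φ : P →+* L) (ψ : P →+* K) (hψ : Function.Injective ψ)
    (hφ : ∀ v, A.map φ *ᵥ v = 0 → ∃ w, B.map φ *ᵥ w = v) :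
    ∀ v, A.map ψ *ᵥ v = 0 → ∃ w, B.map ψ *ᵥ w = v := by
  classical
  have hle : LinearMap.ker (A.map φ).mulVecLin ≤ LinearMap.range (B.map φ).mulVecLin := by
    intro v hv
    exact hφ v hv
  have h1 := Submodule.finrank_mono hle
  have h2 : LinearMap.range (B.map ψ).mulVecLin ≤ LinearMap.ker (A.map ψ).mulVecLin := by
    rintro _ ⟨w, rfl⟩
    have : A.map ψ * B.map ψ = 0 := by
      rw [← Matrix.map_mul, hAB]; ext; simp
    simp [Matrix.mulVec_mulVec, this]
  have h3 : Module.finrank L (LinearMap.range (A.map φ).mulVecLin) ≤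
    Module.finrank K (LinearMap.range (A.map ψ).mulVecLin) := A.rank_map_le_rank_map φ ψ hψ
  have h4 : Module.finrank L (LinearMap.range (B.map φ).mulVecLin) ≤
    Module.finrank K (LinearMap.range (B.map ψ).mulVecLin) := B.rank_map_le_rank_map φ ψ hψ
  have h5 := (A.map φ).mulVecLin.finrank_range_add_finrank_ker
  have h6 := (A.map ψ).mulVecLin.finrank_range_add_finrank_ker
  rw [Module.finrank_fintype_fun_eq_card] at h5 h6
  have h7 := Submodule.eq_of_le_of_finrank_le h2 (by omega)
  intro v hv
  have : v ∈ LinearMap.ker (A.map ψ).mulVecLin := hv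
  rw [← h7] at this
  exact this

/-- The part of `p` which becomes homogeneous of degree `i` after multiplication by a form of
degree `d`. -/
noncomputable def shiftComponent {V R : Type*} [CommRing R] (i d : ℕ) (p : MvPolynomial V R) :
    MvPolynomial V R :=
  if d ≤ i then homogeneousComponent (i - d) p else 0

section shiftComponent

variable {V R : Type*} [CommRing R]

theorem coeff_shiftComponent (i d : ℕ) (p : MvPolynomial V R) (μ : V →₀ ℕ) :
    coeff μ (shiftComponent i d p) = if μ.degree + d = i then coeff μ p else 0 := by
  unfold shiftComponent
  split_ifs with h1 h2 h2
  · rw [coeff_homogeneousComponent, if_pos (by omega)]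
  · rw [coeff_homogeneousComponent, if_neg (by omega)]
  · omega
  · simp

theorem shiftComponent_add (i d : ℕ) (p q : MvPolynomial V R) :
    shiftComponent i d (p + q) = shiftComponent i d p + shiftComponent i d q := by
  ext μ
  simp only [coeff_shiftComponent, coeff_add]
  split_ifs <;> simp

theorem shiftComponent_sub (i d : ℕ) (p q : MvPolynomial V R) :
    shiftComponent i d (p - q) = shiftComponent i d p - shiftComponent i d q := by
  ext μ
  simp only [coeff_shiftComponent, coeff_sub]
  split_ifs <;> simp

theorem shiftComponent_sum {κ : Type*} (i d : ℕ) (s : Finset κ) (p : κ → MvPolynomial V R) :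
    shiftComponent i d (∑ k ∈ s, p k) = ∑ k ∈ s, shiftComponent i d (p k) := by
  ext μ
  simp only [coeff_shiftComponent, coeff_sum]
  split_ifs <;> simp

theorem shiftComponent_eq_self {i d : ℕ} {p : MvPolynomial V R} :
    shiftComponent i d p = p ↔ ∀ μ, coeff μ p ≠ 0 → μ.degree + d = i := by
  constructor
  · intro h μ hμ
    rw [← h, coeff_shiftComponent] at hμ
    by_contra hne
    exact hμ (if_neg hne)
  · intro h
    ext μ
    rw [coeff_shiftComponent]
    split_ifs with h1
    · rfl
    · by_contra hne
      exact h1 (h μ (Ne.symm hne))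

theorem shiftComponent_idem (i d : ℕ) (p : MvPolynomial V R) :
    shiftComponent i d (shiftComponent i d p) = shiftComponent i d p := by
  ext μ
  simp only [coeff_shiftComponent]
  split_ifs <;> rfl

theorem shiftComponent_mul {e : ℕ} {f : MvPolynomial V R} (hf : f.IsHomogeneous e) (i d : ℕ)
    (p : MvPolynomial V R) : shiftComponent i d (f * p) = f * shiftComponent i (d + e) p := by
  classical
  ext μ
  have key : ∀ x ∈ Finset.HasAntidiagonal.antidiagonal μ,
      coeff x.1 f * coeff x.2 (shiftComponent i (d + e) p) =
      if μ.degree + d = i then coeff x.1 f * coeff x.2 p else 0 := by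
    intro x hx
    rw [Finset.HasAntidiagonal.mem_antidiagonal] at hx
    have hdeg : x.1.degree + x.2.degree = μ.degree := by rw [← hx, map_add]
    by_cases h0 : x.1.degree = e
    · rw [coeff_shiftComponent]
      have : (x.2.degree + (d + e) = i) ↔ (μ.degree + d = i) := by omega
      simp only [this]
      split_ifs <;> simp
    · simp [hf.coeff_eq_zero h0]
  rw [coeff_shiftComponent, coeff_mul, coeff_mul, Finset.sum_congr rfl key]
  split_ifs <;> simp

theorem shiftComponent_mul' {e : ℕ} {f : MvPolynomial V R} (hf : f.IsHomogeneous e) (i d : ℕ)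
    (p : MvPolynomial V R) : shiftComponent i d (p * f) = shiftComponent i (d + e) p * f := by
  rw [mul_comm, shiftComponent_mul hf, mul_comm]

theorem shiftComponent_isHomogeneous (i d a : ℕ) (h : a + d = i) (p : MvPolynomial V R) :
    (shiftComponent i d p).IsHomogeneous a := by
  rw [shiftComponent, if_pos (by omega), show i - d = a by omega]
  exact homogeneousComponent_isHomogeneous _ _

theorem shiftComponent_of_lt {i d : ℕ} (h : i < d) (p : MvPolynomial V R) :
    shiftComponent i d p = 0 := if_neg (by omega)

theorem shiftComponent_of_isHomogeneous {i d a : ℕ} (h : a + d = i) {p : MvPolynomial V R}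
    (hp : p.IsHomogeneous a) : shiftComponent i d p = p := by
  rw [shiftComponent_eq_self]
  intro μ hμ
  by_contra hne
  exact hμ (hp.coeff_eq_zero (by omega))

end shiftComponent

/-- In degree `i`, every syzygy of the family `f j`, `j ∈ S`, of forms of degrees `d j` is a
Koszul syzygy. -/
def KoszulSyzygies {V ι R : Type*} [CommRing R] (S : Finset ι) (f : ι → MvPolynomial V R)
    (d : ι → ℕ) (i : ℕ) : Prop :=
  ∀ q : ι → MvPolynomial V R, (∀ j ∈ S, shiftComponent i (d j) (q j) = q j) →
    ∑ j ∈ S, f j * q j = 0 →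
    ∃ h : ι → ι → MvPolynomial V R, ∀ j ∈ S, q j = ∑ k ∈ S, (h j k - h k j) * f k

section specialization

variable {V ι : Type*}

/-- Index set of the monomials in the first term of the Koszul complex in degree `i`. -/
abbrev SyzIndex (V : Type*) {ι : Type*} (S : Finset ι) (d : ι → ℕ) (i : ℕ) : Type _ :=
  { z : ι × (V →₀ ℕ) // z.1 ∈ S ∧ z.2.degree + d z.1 = i }

/-- Index set of the monomials in the second term of the Koszul complex in degree `i`. -/
abbrev KoszulIndex (V : Type*) {ι : Type*} (S : Finset ι) (d : ι → ℕ) (i : ℕ) : Type _ :=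
  { z : (ι × ι) × (V →₀ ℕ) // (z.1.1 ∈ S ∧ z.1.2 ∈ S) ∧ z.2.degree + (d z.1.1 + d z.1.2) = i }

theorem finite_degree_le (V : Type*) [Finite V] (i : ℕ) :
    Set.Finite { μ : V →₀ ℕ | μ.degree ≤ i } := by
  exact Finsupp.finite_of_degree_le i

instance [Finite V] (S : Finset ι) (d : ι → ℕ) (i : ℕ) : Finite (SyzIndex V S d i) := by
  have := (S.finite_toSet.prod (finite_degree_le V i))
  refine (this.subset ?_).to_subtype
  rintro ⟨j, μ⟩ ⟨h1, h2⟩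
  exact ⟨h1, by simp only [Set.mem_ofPred_eq] at *; omega⟩

instance [Finite V] (S : Finset ι) (d : ι → ℕ) (i : ℕ) : Finite (KoszulIndex V S d i) := by
  have := ((S.finite_toSet.prod S.finite_toSet).prod (finite_degree_le V i))
  refine (this.subset ?_).to_subtype
  rintro ⟨j, μ⟩ ⟨h1, h2⟩
  exact ⟨h1, by simp only [Set.mem_ofPred_eq] at *; omega⟩

noncomputable instance [Finite V] (S : Finset ι) (d : ι → ℕ) (i : ℕ) :
    Fintype (SyzIndex V S d i) := Fintype.ofFinite _

noncomputable instance [Finite V] (S : Finset ι) (d : ι → ℕ) (i : ℕ) :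
    Fintype (KoszulIndex V S d i) := Fintype.ofFinite _

variable [Finite V] [DecidableEq ι] {R : Type*} [CommRing R]
  (S : Finset ι) (f : ι → MvPolynomial V R) (d : ι → ℕ) (i : ℕ)

/-- The family of polynomials with given coefficients. -/
noncomputable def syzOfVec (v : SyzIndex V S d i → R) (j : ι) : MvPolynomial V R :=
  ∑ z, if z.1.1 = j then monomial z.1.2 (v z) else 0

/-- The family of polynomials with given coefficients. -/
noncomputable def koszulOfVec (w : KoszulIndex V S d i → R) (j k : ι) : MvPolynomial V R :=
  ∑ z, if z.1.1 = (j, k) then monomial z.1.2 (w z) else 0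

/-- Matrix of the first Koszul map in degree `i`. -/
noncomputable def syzMatrix : Matrix { μ : V →₀ ℕ // μ.degree ≤ i } (SyzIndex V S d i) R :=
  fun ν z => coeff ν.1 (f z.1.1 * monomial z.1.2 1)

/-- Matrix of the second Koszul map in degree `i`. -/
noncomputable def koszulMatrix : Matrix (SyzIndex V S d i) (KoszulIndex V S d i) R :=
  fun y z => (if z.1.1.1 = y.1.1 then coeff y.1.2 (monomial z.1.2 1 * f z.1.1.2) else 0) -
    (if z.1.1.2 = y.1.1 then coeff y.1.2 (monomial z.1.2 1 * f z.1.1.1) else 0)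

theorem coeff_syzOfVec (v : SyzIndex V S d i → R) (j : ι) (μ : V →₀ ℕ) :
    coeff μ (syzOfVec S d i v j) =
      if h : j ∈ S ∧ μ.degree + d j = i then v ⟨(j, μ), h⟩ else 0 := by
  classical
  simp only [syzOfVec, coeff_sum]
  split_ifs with h
  · rw [Finset.sum_eq_single ⟨(j, μ), h⟩]
    · simp
    · rintro ⟨⟨j', μ'⟩, h'⟩ - hne
      by_cases hj : j' = j
      · subst hj
        have : μ' ≠ μ := fun h => hne (by subst h; rfl)
        simp [coeff_monomial, this]
      · simp [hj]
    · simp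
  · refine Finset.sum_eq_zero ?_
    rintro ⟨⟨j', μ'⟩, h'⟩ -
    by_cases hj : j' = j
    · subst hj
      have : μ' ≠ μ := fun h2 => h (by subst h2; exact h')
      simp [coeff_monomial, this]
    · simp [hj]

theorem syzOfVec_coeff (q : ι → MvPolynomial V R)
    (hq : ∀ j ∈ S, shiftComponent i (d j) (q j) = q j) (j : ι) (hj : j ∈ S) :
    syzOfVec S d i (fun z => coeff z.1.2 (q z.1.1)) j = q j := by
  ext μ
  rw [coeff_syzOfVec]
  split_ifs with h
  · rfl
  · by_contra hne
    exact h ⟨hj, shiftComponent_eq_self.1 (hq j hj) μ (Ne.symm hne)⟩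

theorem koszulOfVec_coeff (q : ι → ι → MvPolynomial V R)
    (hq : ∀ j ∈ S, ∀ k ∈ S, shiftComponent i (d j + d k) (q j k) = q j k)
    (j k : ι) (hj : j ∈ S) (hk : k ∈ S) :
    koszulOfVec S d i (fun z => coeff z.1.2 (q z.1.1.1 z.1.1.2)) j k = q j k := by
  classical
  ext μ
  simp only [koszulOfVec, coeff_sum]
  by_cases h : μ.degree + (d j + d k) = i
  · rw [Finset.sum_eq_single ⟨((j, k), μ), ⟨hj, hk⟩, h⟩]
    · simp
    · rintro ⟨⟨⟨j', k'⟩, μ'⟩, h'⟩ - hne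
      by_cases hj : (j', k') = (j, k)
      · rw [Prod.mk.injEq] at hj
        obtain ⟨rfl, rfl⟩ := hj
        have : μ' ≠ μ := fun h => hne (by subst h; rfl)
        simp [coeff_monomial, this]
      · simp [hj]
    · simp
  · have h0 : coeff μ (q j k) = 0 := by
      by_contra hne
      exact h (shiftComponent_eq_self.1 (hq j hj k hk) μ hne)
    rw [h0]
    refine Finset.sum_eq_zero ?_
    rintro ⟨⟨⟨j', k'⟩, μ'⟩, h'⟩ -
    by_cases hj : (j', k') = (j, k)
    · rw [Prod.mk.injEq] at hj
      obtain ⟨rfl, rfl⟩ := hj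
      have : μ' ≠ μ := fun h2 => h (by subst h2; exact h'.2)
      simp [coeff_monomial, this]
    · simp [hj]

theorem syzMatrix_mulVec (v : SyzIndex V S d i → R) (ν : { μ : V →₀ ℕ // μ.degree ≤ i }) :
    (syzMatrix S f d i *ᵥ v) ν = coeff ν.1 (∑ j ∈ S, f j * syzOfVec S d i v j) := by
  have h1 : ∑ j ∈ S, f j * syzOfVec S d i v j =
      ∑ z : SyzIndex V S d i, f z.1.1 * monomial z.1.2 (v z) := by
    simp only [syzOfVec, Finset.mul_sum]
    rw [Finset.sum_comm]
    refine Finset.sum_congr rfl fun z _ => ?_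
    simp [mul_ite, z.2.1]
  rw [h1, coeff_sum]
  refine Finset.sum_congr rfl fun z _ => ?_
  have : (monomial z.1.2 (v z) : MvPolynomial V R) = C (v z) * monomial z.1.2 1 := by
    rw [C_mul_monomial, mul_one]
  rw [this, mul_left_comm, coeff_C_mul, mul_comm]
  rfl

theorem shiftComponent_syzOfVec (v : SyzIndex V S d i → R) (j : ι) :
    shiftComponent i (d j) (syzOfVec S d i v j) = syzOfVec S d i v j := by
  rw [shiftComponent_eq_self]
  intro μ hμ
  rw [coeff_syzOfVec] at hμ
  by_contra hne
  exact hμ (dif_neg (by tauto))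

variable {S f d} in
theorem syzMatrix_mulVec_eq_zero_iff (hf : ∀ j ∈ S, (f j).IsHomogeneous (d j))
    (v : SyzIndex V S d i → R) :
    syzMatrix S f d i *ᵥ v = 0 ↔ ∑ j ∈ S, f j * syzOfVec S d i v j = 0 := by
  constructor
  · intro h
    have h1 : shiftComponent i 0 (∑ j ∈ S, f j * syzOfVec S d i v j) =
        ∑ j ∈ S, f j * syzOfVec S d i v j := by
      rw [shiftComponent_sum]
      refine Finset.sum_congr rfl fun j hj => ?_
      rw [shiftComponent_mul (hf j hj), zero_add, shiftComponent_syzOfVec]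
    ext ν
    by_contra hne
    have h2 := shiftComponent_eq_self.1 h1 ν hne
    have h3 := congrFun h ⟨ν, by omega⟩
    rw [syzMatrix_mulVec] at h3
    exact hne h3
  · intro h
    ext ν
    rw [syzMatrix_mulVec, h]
    simp

variable {S f d} in
theorem syzOfVec_koszulMatrix_mulVec (hf : ∀ j ∈ S, (f j).IsHomogeneous (d j))
    (w : KoszulIndex V S d i → R) (j : ι) (hj : j ∈ S) :
    syzOfVec S d i (koszulMatrix S f d i *ᵥ w) j =
      ∑ k ∈ S, (koszulOfVec S d i w j k - koszulOfVec S d i w k j) * f k := by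
  classical
  have h1 : ∑ k ∈ S, (koszulOfVec S d i w j k - koszulOfVec S d i w k j) * f k =
      ∑ z : KoszulIndex V S d i, ((if z.1.1.1 = j then monomial z.1.2 (w z) * f z.1.1.2 else 0) -
        (if z.1.1.2 = j then monomial z.1.2 (w z) * f z.1.1.1 else 0)) := by
    simp only [sub_mul, Finset.sum_sub_distrib, koszulOfVec, Finset.sum_mul]
    congr 1
    · rw [Finset.sum_comm]
      refine Finset.sum_congr rfl fun z _ => ?_
      obtain ⟨⟨⟨j', k'⟩, μ'⟩, h'⟩ := z
      by_cases hjj : j' = j <;> simp [hjj, h'.1.2]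
    · rw [Finset.sum_comm]
      refine Finset.sum_congr rfl fun z _ => ?_
      obtain ⟨⟨⟨j', k'⟩, μ'⟩, h'⟩ := z
      by_cases hjj : k' = j <;> simp [hjj, h'.1.1]
  rw [h1]
  have mono (z : KoszulIndex V S d i) :
      (monomial z.1.2 (w z) : MvPolynomial V R) = C (w z) * monomial z.1.2 1 := by
    rw [C_mul_monomial, mul_one]
  ext μ
  rw [coeff_syzOfVec, coeff_sum]
  split_ifs with h
  · refine Finset.sum_congr rfl fun z _ => ?_
    simp only [koszulMatrix, mono, coeff_sub, mul_assoc]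
    split_ifs <;> simp [coeff_C_mul] <;> ring
  · symm
    refine Finset.sum_eq_zero fun z _ => ?_
    have hμ : μ.degree + d j ≠ i := fun h2 => h ⟨hj, h2⟩
    have hz := z.2.2
    have hh (k : ι) (hk : k ∈ S) (hne : μ.degree ≠ z.1.2.degree + d k) :
        coeff μ (monomial z.1.2 (w z) * f k) = 0 :=
      ((isHomogeneous_monomial (w z) rfl).mul (hf k hk)).coeff_eq_zero hne
    rw [coeff_sub]
    have e1 : coeff μ (if z.1.1.1 = j then monomial z.1.2 (w z) * f z.1.1.2 else 0) = 0 := by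
      split_ifs with h3
      · rw [h3] at hz
        exact hh _ z.2.1.2 (by omega)
      · simp
    have e2 : coeff μ (if z.1.1.2 = j then monomial z.1.2 (w z) * f z.1.1.1 else 0) = 0 := by
      split_ifs with h3
      · rw [h3] at hz
        exact hh _ z.2.1.1 (by omega)
      · simp
    rw [e1, e2, sub_zero]

omit [DecidableEq ι] in
theorem sum_koszul_eq_zero {A : Type*} [CommRing A] (f : ι → A) (h : ι → ι → A) :
    ∑ j ∈ S, f j * ∑ k ∈ S, (h j k - h k j) * f k = 0 := by
  simp only [sub_mul, Finset.sum_sub_distrib, mul_sub, Finset.mul_sum]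
  rw [sub_eq_zero, Finset.sum_comm]
  exact Finset.sum_congr rfl fun j _ => Finset.sum_congr rfl fun k _ => by ring

variable {S f d} in
theorem syzMatrix_mul_koszulMatrix (hf : ∀ j ∈ S, (f j).IsHomogeneous (d j)) :
    syzMatrix S f d i * koszulMatrix S f d i = 0 := by
  classical
  apply Matrix.toLin'.injective
  refine LinearMap.ext fun w => ?_
  rw [Matrix.toLin'_mul_apply, Matrix.toLin'_apply, Matrix.toLin'_apply,
    (syzMatrix_mulVec_eq_zero_iff i hf _).2, map_zero, LinearMap.zero_apply]
  rw [← sum_koszul_eq_zero S f (koszulOfVec S d i w)]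
  exact Finset.sum_congr rfl fun j hj => by rw [syzOfVec_koszulMatrix_mulVec i hf w j hj]

variable {S f d} in
theorem koszulSyzygies_iff (hf : ∀ j ∈ S, (f j).IsHomogeneous (d j)) :
    KoszulSyzygies S f d i ↔
      ∀ v, syzMatrix S f d i *ᵥ v = 0 → ∃ w, koszulMatrix S f d i *ᵥ w = v := by
  constructor
  · intro H v hv
    rw [syzMatrix_mulVec_eq_zero_iff i hf] at hv
    obtain ⟨h, hh⟩ := H _ (fun j _ => shiftComponent_syzOfVec S d i v j) hv
    refine ⟨fun z => coeff z.1.2 (shiftComponent i (d z.1.1.1 + d z.1.1.2)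
      (h z.1.1.1 z.1.1.2)), ?_⟩
    ext ⟨⟨j, μ⟩, hj, hμ⟩
    have e1 := coeff_syzOfVec S d i v j μ
    rw [dif_pos ⟨hj, hμ⟩] at e1
    have e2 := coeff_syzOfVec S d i (koszulMatrix S f d i *ᵥ fun z => coeff z.1.2
      (shiftComponent i (d z.1.1.1 + d z.1.1.2) (h z.1.1.1 z.1.1.2))) j μ
    rw [dif_pos ⟨hj, hμ⟩] at e2
    rw [← e1, ← e2, syzOfVec_koszulMatrix_mulVec i hf _ j hj, ← shiftComponent_syzOfVec S d i v j,
      hh j hj, shiftComponent_sum]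
    congr 1
    refine Finset.sum_congr rfl fun k hk => ?_
    rw [shiftComponent_mul' (hf k hk), shiftComponent_sub]
    have aux := koszulOfVec_coeff S d i (fun j k => shiftComponent i (d j + d k) (h j k))
      (fun _ _ _ _ => shiftComponent_idem _ _ _)
    rw [aux j k hj hk, aux k j hk hj, add_comm (d k)]
  · intro H q hq hsum
    have e1 : ∀ j ∈ S, _ := syzOfVec_coeff S d i q hq
    obtain ⟨w, hw⟩ := H (fun z => coeff z.1.2 (q z.1.1)) (by
      rw [syzMatrix_mulVec_eq_zero_iff i hf, ← hsum]
      exact Finset.sum_congr rfl fun j hj => by rw [e1 j hj])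
    refine ⟨koszulOfVec S d i w, fun j hj => ?_⟩
    rw [← syzOfVec_koszulMatrix_mulVec i hf w j hj, hw, e1 j hj]

omit [Finite V] [DecidableEq ι] in
theorem syzMatrix_map {A : Type*} [CommRing A] (χ : R →+* A) :
    (syzMatrix S f d i).map χ = syzMatrix S (fun j => map χ (f j)) d i := by
  ext ν z
  simp only [syzMatrix, Matrix.map_apply, ← coeff_map, map_mul, map_monomial, map_one]

omit [Finite V] in
theorem koszulMatrix_map {A : Type*} [CommRing A] (χ : R →+* A) :
    (koszulMatrix S f d i).map χ = koszulMatrix S (fun j => map χ (f j)) d i := by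
  ext ν z
  simp only [koszulMatrix, Matrix.map_apply, map_sub, apply_ite χ, map_zero, ← coeff_map,
    map_mul, map_monomial, map_one]

variable {S f d i} in
/-- Exactness of the Koszul complex in a given degree passes from a specialization to the generic
point. -/
theorem KoszulSyzygies.of_specialization {L K : Type*} [Field L] [Field K]
    (hf : ∀ j ∈ S, (f j).IsHomogeneous (d j)) (φ : R →+* L) (ψ : R →+* K)
    (hψ : Function.Injective ψ) (H : KoszulSyzygies S (fun j => map φ (f j)) d i) :
    KoszulSyzygies S (fun j => map ψ (f j)) d i := by
  have : Finite { μ : V →₀ ℕ // μ.degree ≤ i } := (finite_degree_le V i).to_subtype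
  have := Fintype.ofFinite { μ : V →₀ ℕ // μ.degree ≤ i }
  rw [koszulSyzygies_iff i fun j hj => (hf j hj).map ψ, ← syzMatrix_map, ← koszulMatrix_map]
  rw [koszulSyzygies_iff i fun j hj => (hf j hj).map φ, ← syzMatrix_map, ← koszulMatrix_map] at H
  exact Matrix.exact_map_of_exact_map _ _ (syzMatrix_mul_koszulMatrix i hf) φ ψ hψ H

end specialization

end matrices

section colon

variable {V ι R : Type*} [CommRing R] {S : Finset ι} {f : ι → MvPolynomial V R} {d : ι → ℕ}

theorem mem_span_image_iff_exists_sum {A : Type*} [CommRing A] {f : ι → A} {x : A} :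
    x ∈ Ideal.span (f '' (S : Set ι)) ↔ ∃ r : ι → A, x = ∑ j ∈ S, f j * r j := by
  rw [Ideal.span, Submodule.mem_span_image_finset_iff_exists_fun']
  simp only [smul_eq_mul, mul_comm, eq_comm]

theorem exists_shiftComponent_sum (hf : ∀ j ∈ S, (f j).IsHomogeneous (d j)) {i e : ℕ}
    {x : MvPolynomial V R} (hx : x ∈ Ideal.span (f '' (S : Set ι))) :
    ∃ r : ι → MvPolynomial V R, (∀ j, shiftComponent i (e + d j) (r j) = r j) ∧
      shiftComponent i e x = ∑ j ∈ S, f j * r j := by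
  obtain ⟨r, rfl⟩ := mem_span_image_iff_exists_sum.1 hx
  refine ⟨fun j => shiftComponent i (e + d j) (r j), fun j => shiftComponent_idem _ _ _, ?_⟩
  rw [shiftComponent_sum]
  exact Finset.sum_congr rfl fun j hj => shiftComponent_mul (hf j hj) _ _ _

theorem shiftComponent_mem_span (hf : ∀ j ∈ S, (f j).IsHomogeneous (d j)) (i e : ℕ)
    {x : MvPolynomial V R} (hx : x ∈ Ideal.span (f '' (S : Set ι))) :
    shiftComponent i e x ∈ Ideal.span (f '' (S : Set ι)) := by
  obtain ⟨r, -, hr⟩ := exists_shiftComponent_sum hf (i := i) (e := e) hx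
  exact mem_span_image_iff_exists_sum.2 ⟨r, hr⟩

theorem KoszulSyzygies.congr {f' : ι → MvPolynomial V R} (h : ∀ j ∈ S, f j = f' j) {i : ℕ}
    (H : KoszulSyzygies S f d i) : KoszulSyzygies S f' d i := by
  intro q hq hsum
  obtain ⟨r, hr⟩ := H q hq ((Finset.sum_congr rfl fun j hj => by rw [h j hj]).trans hsum)
  exact ⟨r, fun j hj => (hr j hj).trans (Finset.sum_congr rfl fun k hk => by rw [h k hk])⟩

theorem KoszulSyzygies.insert_of_colon [DecidableEq ι] {j₀ : ι} (hj₀ : j₀ ∉ S) {i : ℕ}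
    (hf : ∀ j ∈ insert j₀ S, (f j).IsHomogeneous (d j)) (hS : KoszulSyzygies S f d i)
    (hcolon : ∀ p, shiftComponent i (d j₀) p = p →
      f j₀ * p ∈ Ideal.span (f '' (S : Set ι)) → p ∈ Ideal.span (f '' (S : Set ι))) :
    KoszulSyzygies (insert j₀ S) f d i := by
  intro q hq hsum
  rw [Finset.sum_insert hj₀] at hsum
  have hfS : ∀ j ∈ S, (f j).IsHomogeneous (d j) := fun j hj =>
    hf j (Finset.mem_insert_of_mem hj)
  have hp := hcolon (q j₀) (hq j₀ (Finset.mem_insert_self _ _)) (by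
    rw [eq_neg_of_add_eq_zero_left hsum]
    exact neg_mem (mem_span_image_iff_exists_sum.2 ⟨q, rfl⟩))
  obtain ⟨r, hr, hpr⟩ := exists_shiftComponent_sum hfS (i := i) (e := d j₀) hp
  rw [hq j₀ (Finset.mem_insert_self _ _)] at hpr
  obtain ⟨h, hh⟩ := hS (fun j => q j + r j * f j₀)
    (fun j hj => by
      rw [shiftComponent_add, hq j (Finset.mem_insert_of_mem hj),
        shiftComponent_mul' (hf j₀ (Finset.mem_insert_self _ _)), add_comm (d j), hr])
    (by
      rw [← hsum, hpr, Finset.mul_sum, add_comm, ← Finset.sum_add_distrib]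
      exact Finset.sum_congr rfl fun j _ => by ring)
  refine ⟨fun j k => if j = j₀ then (if k = j₀ then 0 else r k)
    else if k = j₀ then 0 else h j k, fun j hj => ?_⟩
  rw [Finset.sum_insert hj₀]
  rcases Finset.mem_insert.1 hj with rfl | hjS
  · rw [hpr]
    simp only [sub_self, zero_mul, zero_add]
    refine Finset.sum_congr rfl fun k hk => ?_
    have hk' : k ≠ j := fun h => hj₀ (h ▸ hk)
    simp [hk', mul_comm]
  · have hj' : j ≠ j₀ := fun h => hj₀ (h ▸ hjS)
    have e : ∑ k ∈ S, (h j k - h k j) * f k = ∑ k ∈ S,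
        ((if j = j₀ then (if k = j₀ then 0 else r k) else if k = j₀ then 0 else h j k) -
        (if k = j₀ then (if j = j₀ then 0 else r j) else if j = j₀ then 0 else h k j)) * f k := by
      refine Finset.sum_congr rfl fun k hk => ?_
      have hk' : k ≠ j₀ := fun h => hj₀ (h ▸ hk)
      simp [hk', hj']
    rw [← e, ← hh j hjS]
    simp [hj']

theorem KoszulSyzygies.mem_of_colon [DecidableEq ι] {j₀ : ι} (hj₀ : j₀ ∉ S) {i : ℕ}
    (hf : ∀ j ∈ insert j₀ S, (f j).IsHomogeneous (d j))
    (H : KoszulSyzygies (insert j₀ S) f d i) {p : MvPolynomial V R}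
    (hp : shiftComponent i (d j₀) p = p)
    (hmem : f j₀ * p ∈ Ideal.span (f '' (S : Set ι))) :
    p ∈ Ideal.span (f '' (S : Set ι)) := by
  have hfS : ∀ j ∈ S, (f j).IsHomogeneous (d j) := fun j hj =>
    hf j (Finset.mem_insert_of_mem hj)
  obtain ⟨r, hr, hpr⟩ := exists_shiftComponent_sum hfS (i := i) (e := 0) hmem
  rw [shiftComponent_mul (hf j₀ (Finset.mem_insert_self _ _)), zero_add, hp] at hpr
  simp only [zero_add] at hr
  have hne : ∀ k ∈ S, k ≠ j₀ := fun k hk h => hj₀ (h ▸ hk)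
  obtain ⟨h, hh⟩ := H (fun j => if j = j₀ then p else - r j)
    (fun j hj => by
      by_cases hjj : j = j₀
      · simp [hjj, hp]
      · simp only [if_neg hjj]
        rw [← zero_sub, shiftComponent_sub, hr]
        simp [shiftComponent])
    (by
      rw [Finset.sum_insert hj₀, if_pos rfl, hpr, ← Finset.sum_add_distrib]
      exact Finset.sum_eq_zero fun k hk => by simp [hne k hk])
  have := hh j₀ (Finset.mem_insert_self _ _)
  rw [if_pos rfl, Finset.sum_insert hj₀, sub_self, zero_mul, zero_add] at this
  rw [this, mem_span_image_iff_exists_sum]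
  exact ⟨fun k => h j₀ k - h k j₀, Finset.sum_congr rfl fun k _ => mul_comm _ _⟩

theorem mem_span_of_forall_shiftComponent {I : Ideal (MvPolynomial V R)} (e : ℕ)
    {y : MvPolynomial V R} (h : ∀ i, shiftComponent i e y ∈ I) : y ∈ I := by
  rw [← sum_homogeneousComponent y]
  refine sum_mem fun a _ => ?_
  have := h (a + e)
  rwa [shiftComponent, if_pos (by omega), Nat.add_sub_cancel] at this

theorem colon_of_forall_shiftComponent {j₀ : ι}
    (hf : ∀ j ∈ S, (f j).IsHomogeneous (d j)) (hf₀ : (f j₀).IsHomogeneous (d j₀))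
    (H : ∀ i p, shiftComponent i (d j₀) p = p →
      f j₀ * p ∈ Ideal.span (f '' (S : Set ι)) → p ∈ Ideal.span (f '' (S : Set ι)))
    {y : MvPolynomial V R} (hy : f j₀ * y ∈ Ideal.span (f '' (S : Set ι))) :
    y ∈ Ideal.span (f '' (S : Set ι)) := by
  refine mem_span_of_forall_shiftComponent (d j₀) fun i => ?_
  refine H i _ (shiftComponent_idem _ _ _) ?_
  have := shiftComponent_mem_span hf i 0 hy
  rwa [shiftComponent_mul hf₀, zero_add] at this

theorem KoszulSyzygies.mem_of_mul_mem [DecidableEq ι] {j₀ : ι} (hj₀ : j₀ ∉ S)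
    (hf : ∀ j ∈ insert j₀ S, (f j).IsHomogeneous (d j))
    (H : ∀ i, KoszulSyzygies (insert j₀ S) f d i) {y : MvPolynomial V R}
    (hy : f j₀ * y ∈ Ideal.span (f '' (S : Set ι))) :
    y ∈ Ideal.span (f '' (S : Set ι)) :=
  colon_of_forall_shiftComponent (fun j hj => hf j (Finset.mem_insert_of_mem hj))
    (hf j₀ (Finset.mem_insert_self _ _)) (fun i _ hp => (H i).mem_of_colon hj₀ hf hp) hy

theorem koszulSyzygies_X_pow [Nontrivial R] {v : ι → V} [DecidableEq ι] (S : Finset ι)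
    (hv : Set.InjOn v S) (e : ι → ℕ) (i : ℕ) :
    KoszulSyzygies S (fun j => (X (v j) ^ e j : MvPolynomial V R)) e i := by
  induction S using Finset.induction_on with
  | empty => exact fun q _ _ => ⟨0, by simp⟩
  | insert j₀ S hj₀ ih =>
    refine KoszulSyzygies.insert_of_colon hj₀
      (fun j _ => by simpa using (isHomogeneous_X R (v j)).pow (e j))
      (ih (hv.mono (by simp))) fun p _ hp => ?_
    have himg : (fun j => (X (v j) ^ e j : MvPolynomial V R)) '' (S : Set ι) =
        (fun s => monomial s (1 : R)) '' ((fun j => Finsupp.single (v j) (e j)) '' (S : Set ι)) := by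
      rw [Set.image_image]
      simp only [X_pow_eq_monomial]
    rw [himg, mem_ideal_span_monomial_image] at hp ⊢
    intro μ hμ
    obtain ⟨-, ⟨j, hj, rfl⟩, hle⟩ := hp (Finsupp.single (v j₀) (e j₀) + μ) (by
      rw [mem_support_iff, X_pow_eq_monomial, coeff_monomial_mul, one_mul]
      exact mem_support_iff.1 hμ)
    refine ⟨_, ⟨j, hj, rfl⟩, ?_⟩
    have hne : v j₀ ≠ v j := fun h => hj₀ (by
      have := hv (by simp) (by simp [Finset.mem_coe.1 hj]) h
      exact this ▸ hj)
    rw [Finsupp.single_le_iff] at hle ⊢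
    simpa [Finsupp.single_apply, hne] using hle

end colon

theorem LinearMap.exists_injective_add_smul {K V W : Type*} [Field K] [Infinite K]
    [AddCommGroup V] [Module K V] [FiniteDimensional K V] [AddCommGroup W] [Module K W]
    (M₀ M₁ : V →ₗ[K] W)
    (h : ∀ v₀ v₁, M₀ v₀ = 0 → M₁ v₀ + M₀ v₁ = 0 → v₀ = 0) :
    ∃ t : K, Function.Injective (M₀ + t • M₁) := by
  obtain ⟨π, hπ⟩ := (LinearMap.ker M₀).subtype.exists_leftInverse_of_injective
    (Submodule.ker_subtype _)
  have hπ₀ (v : V) : M₀ (π v) = 0 := (π v).2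
  have hπ₁ (v : V) (hv : M₀ v = 0) : (π v : V) = v :=
    congrArg Subtype.val (LinearMap.congr_fun hπ ⟨v, hv⟩)
  let P : V →ₗ[K] V := (LinearMap.ker M₀).subtype ∘ₗ π
  have hP (v : V) : P v = π v := rfl
  have hPP (v : V) : P (P v) = P v := hπ₁ _ (hπ₀ v)
  obtain ⟨B, hB⟩ := (M₀ + M₁ ∘ₗ P).exists_leftInverse_of_injective (by
    rw [LinearMap.ker_eq_bot']
    intro v hv
    simp only [LinearMap.add_apply, LinearMap.comp_apply] at hv
    have hPv : P v = 0 := h _ v (hπ₀ v) (by rwa [add_comm])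
    rw [hPv, map_zero, add_zero] at hv
    rw [← hπ₁ v hv, ← hP, hPv])
  obtain ⟨μ, hμ⟩ := ((Module.End.finite_hasEigenvalue (B ∘ₗ M₁ ∘ₗ (LinearMap.id - P))).insert
    0).exists_notMem
  rw [Set.mem_insert_iff, not_or] at hμ
  obtain ⟨hμ₀, hμ⟩ := hμ
  refine ⟨-μ⁻¹, ?_⟩
  rw [← LinearMap.ker_eq_bot, LinearMap.ker_eq_bot']
  intro x hx
  simp only [LinearMap.add_apply, LinearMap.smul_apply] at hx
  set y : V := x - P x + (-μ⁻¹) • P x with hy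
  have hPy : P y = (-μ⁻¹) • P x := by
    simp only [hy, map_add, map_sub, map_smul, hPP, sub_self, zero_add]
  have hN : (M₀ + M₁ ∘ₗ P) y + (-μ⁻¹) • M₁ (y - P y) = 0 := by
    have e : y - P y = x - P x := by rw [hPy, hy]; abel
    rw [e, ← hx, LinearMap.add_apply, LinearMap.comp_apply, hPy, hy]
    simp only [map_add, map_sub, map_smul, hP, hπ₀, smul_sub]
    simp only [smul_zero]
    abel
  have hBy := congrArg B hN
  rw [map_add, map_smul, map_zero, ← LinearMap.comp_apply, hB, LinearMap.id_apply] at hBy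
  have hyE : (B ∘ₗ M₁ ∘ₗ (LinearMap.id - P)) y = μ • y := by
    have : y = μ⁻¹ • B (M₁ (y - P y)) := by
      rw [neg_smul] at hBy
      exact eq_of_sub_eq_zero (by rw [sub_eq_add_neg]; exact hBy)
    conv_rhs => rw [this, smul_inv_smul₀ hμ₀]
    rfl
  have hy₀ : y = 0 := by
    by_contra hne
    exact hμ (Module.End.hasEigenvalue_of_hasEigenvector
      ⟨Module.End.mem_eigenspace_iff.2 hyE, hne⟩)
  have hPx : P x = 0 := by
    rw [hy₀, map_zero] at hPy
    exact (smul_eq_zero.1 hPy.symm).resolve_left (by simpa using hμ₀)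
  rw [hPx, sub_zero, smul_zero, add_zero] at hy
  rw [← hy, hy₀]

theorem MvPolynomial.finite_homogeneousSubmodule (V K : Type*) [Finite V] [Field K] (a : ℕ) :
    Module.Finite K (homogeneousSubmodule V K a) := by
  have : Finite { μ : V →₀ ℕ | μ.degree = a } :=
    ((Finsupp.finite_of_degree_le a).subset fun μ hμ => le_of_eq hμ).to_subtype
  rw [homogeneousSubmodule_eq_finsupp_supported]
  exact Module.Finite.of_basis (basisRestrictSupport K { μ : V →₀ ℕ | μ.degree = a })

section prodForm

variable {V R : Type*} [CommRing R]

/-- The linear form in the variables `W` with coefficients in row `s` of `b`. -/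
noncomputable def linForm (W : Finset V) (b : ℕ → V → R) (s : ℕ) : MvPolynomial V R :=
  ∑ v ∈ W, C (b s v) * X v

/-- The product of the linear forms in the variables `W` given by the rows of `b` in `t`. -/
noncomputable def prodForm (W : Finset V) (b : ℕ → V → R) (t : Finset ℕ) : MvPolynomial V R :=
  ∏ s ∈ t, linForm W b s

theorem prodForm_isHomogeneous (W : Finset V) (b : ℕ → V → R) (t : Finset ℕ) :
    (prodForm W b t).IsHomogeneous t.card := by
  rw [Finset.card_eq_sum_ones]
  refine IsHomogeneous.prod _ _ _ fun s _ => IsHomogeneous.sum _ _ _ fun v _ => ?_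
  simpa using (isHomogeneous_C V (b s v)).mul (isHomogeneous_X R v)

theorem map_prodForm {A : Type*} [CommRing A] (χ : R →+* A) (W : Finset V) (b : ℕ → V → R)
    (t : Finset ℕ) : map χ (prodForm W b t) = prodForm W (fun s v => χ (b s v)) t := by
  simp [prodForm, linForm, map_prod, map_sum]

theorem linForm_indicator [DecidableEq V] {W : Finset V} {w : V} (hw : w ∈ W) {b : ℕ → V → R}
    {s : ℕ} (h : ∀ v ∈ W, b s v = if v = w then 1 else 0) : linForm W b s = X w := by
  rw [linForm, Finset.sum_eq_single_of_mem w hw fun v hv hne => by simp [h v hv, hne]]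
  simp [h w hw]

theorem linForm_congr {W : Finset V} {b b' : ℕ → V → R} {s : ℕ} (h : ∀ v ∈ W, b s v = b' s v) :
    linForm W b s = linForm W b' s :=
  Finset.sum_congr rfl fun v hv => by rw [h v hv]

theorem prodForm_congr {W : Finset V} {b b' : ℕ → V → R} {t : Finset ℕ}
    (h : ∀ s ∈ t, ∀ v ∈ W, b s v = b' s v) : prodForm W b t = prodForm W b' t :=
  Finset.prod_congr rfl fun s hs => linForm_congr (h s hs)

theorem prodForm_empty (W : Finset V) (b : ℕ → V → R) : prodForm W b ∅ = 1 := rfl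

theorem prodForm_erase {W : Finset V} {b : ℕ → V → R} {t : Finset ℕ} {s : ℕ} (hs : s ∈ t) :
    prodForm W b t = linForm W b s * prodForm W b (t.erase s) :=
  (Finset.mul_prod_erase t _ hs).symm

theorem prodForm_union {W : Finset V} {b : ℕ → V → R} {t t' : Finset ℕ} (h : Disjoint t t') :
    prodForm W b (t ∪ t') = prodForm W b t * prodForm W b t' :=
  Finset.prod_union h

end prodForm

section rows

variable {V ι K k : Type*} [Finite V] [DecidableEq V] [DecidableEq ι] [Field k] [Field K]
  [Algebra k K]

theorem koszulSyzygies_prodForm_of_specialization {R L : Type*} [CommRing R] [Field L]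
    {S : Finset ι} {W : Finset V} {T : ι → Finset ℕ} {v : ι → V} (hv : Set.InjOn v S)
    (hvW : ∀ j ∈ S, v j ∈ W) (b : ℕ → V → R) (φ : R →+* L)
    (hφ : ∀ j ∈ S, ∀ s ∈ T j, ∀ v' ∈ W, φ (b s v') = if v' = v j then 1 else 0)
    (ψ : R →+* K) (hψ : Function.Injective ψ) (i : ℕ) :
    KoszulSyzygies S (fun j => prodForm W (fun s v => ψ (b s v)) (T j))
      (fun j => (T j).card) i := by
  simp only [← map_prodForm]
  refine KoszulSyzygies.of_specialization (fun j _ => prodForm_isHomogeneous _ _ _) φ ψ hψ ?_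
  refine (koszulSyzygies_X_pow S hv (fun j => (T j).card) i).congr fun j hj => ?_
  rw [map_prodForm, prodForm, Finset.prod_congr rfl fun s hs =>
    linForm_indicator (hvW j hj) (hφ j hj s hs), Finset.prod_const]

/-- Replace the rows in `A` of a matrix by the row of the variable `w`. -/
def replaceRows {R : Type*} [Zero R] [One R] (A : Finset ℕ) (w : V) (c : ℕ → V → R) (s : ℕ)
    (v : V) : R :=
  if s ∈ A then (if v = w then 1 else 0) else c s v

theorem koszulSyzygies_replaceRows {c : ℕ → V → K}
    (hc : AlgebraicIndependent k fun p : ℕ × V => c p.1 p.2)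
    {S : Finset ι} {W : Finset V} {T : ι → Finset ℕ} {v : ι → V} (hv : Set.InjOn v S)
    (hvW : ∀ j ∈ S, v j ∈ W) (hT : (S : Set ι).PairwiseDisjoint T) (A : Finset ℕ) (w : V)
    (hA : ∀ s ∈ A, ∀ j ∈ S, s ∈ T j → v j = w) (i : ℕ) :
    KoszulSyzygies S (fun j => prodForm W (replaceRows A w c) (T j))
      (fun j => (T j).card) i := by
  classical
  have key := koszulSyzygies_prodForm_of_specialization hv hvW
    (T := T) (replaceRows A w fun s v => (X (s, v) : MvPolynomial (ℕ × V) k))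
    (φ := eval fun p : ℕ × V => if ∃ j ∈ S, p.1 ∈ T j ∧ p.2 = v j then (1 : k) else 0)
    ?_ (aeval (R := k) fun p : ℕ × V => c p.1 p.2).toRingHom hc i
  · convert key using 4 with j s v'
    unfold replaceRows
    split_ifs <;> simp
  · intro j hj s hs v' hv'
    unfold replaceRows
    split_ifs with h1 h2 h3 h4 h5
    · simp
    · exact absurd (h2.trans (hA s h1 j hj hs).symm) h3
    · exact absurd (h4.trans (hA s h1 j hj hs)) h2
    · simp
    · simp only [eval_X]
      rw [if_pos ⟨j, hj, hs, h5⟩]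
    · simp only [eval_X]
      rw [if_neg]
      rintro ⟨j', hj', hs', rfl⟩
      have : j = j' := by
        by_contra hne
        exact Finset.disjoint_left.1 (hT hj hj' hne) hs hs'
      exact h5 (this ▸ rfl)

end rows

theorem Ideal.exists_add_C_mul_mul_mem {V K : Type*} [Finite V] [Field K] [Infinite K]
    (I : Ideal (MvPolynomial V K)) (m₀ m₁ : MvPolynomial V K) (a : ℕ)
    (h : ∀ p₀ p₁ : MvPolynomial V K, p₀.IsHomogeneous a → p₁.IsHomogeneous a →
      m₀ * p₀ ∈ I → m₁ * p₀ + m₀ * p₁ ∈ I → p₀ ∈ I) :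
    ∃ t : K, ∀ p : MvPolynomial V K, p.IsHomogeneous a → (m₀ + C t * m₁) * p ∈ I → p ∈ I := by
  have := MvPolynomial.finite_homogeneousSubmodule V K a
  let π := (Ideal.Quotient.mkₐ K I).toLinearMap
  let U := (homogeneousSubmodule V K a).map π
  let M (m : MvPolynomial V K) : U →ₗ[K] (MvPolynomial V K ⧸ I) :=
    (LinearMap.mulLeft K (Ideal.Quotient.mk I m)).domRestrict U
  obtain ⟨t, ht⟩ := LinearMap.exists_injective_add_smul (M m₀) (M m₁) (by
    rintro ⟨_, p₀, hp₀, rfl⟩ ⟨_, p₁, hp₁, rfl⟩ h₀ h₁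
    have h₀' : Ideal.Quotient.mk I (m₀ * p₀) = 0 := by rw [map_mul]; exact h₀
    have h₁' : Ideal.Quotient.mk I (m₁ * p₀ + m₀ * p₁) = 0 := by
      rw [map_add, map_mul, map_mul]; exact h₁
    refine Subtype.ext ?_
    exact Ideal.Quotient.eq_zero_iff_mem.2 (h p₀ p₁ hp₀ hp₁
      (Ideal.Quotient.eq_zero_iff_mem.1 h₀') (Ideal.Quotient.eq_zero_iff_mem.1 h₁')))
  refine ⟨t, fun p hp hmem => ?_⟩
  have hx : (⟨π p, p, hp, rfl⟩ : U) = 0 := ht (by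
    rw [map_zero]
    change Ideal.Quotient.mk I (m₀ * p + t • (m₁ * p)) = 0
    rw [Ideal.Quotient.eq_zero_iff_mem, smul_eq_C_mul, ← mul_assoc, ← add_mul]
    exact hmem)
  exact Ideal.Quotient.eq_zero_iff_mem.1 (congrArg Subtype.val hx)

section rows

variable {V ι K k : Type*} [Finite V] [DecidableEq V] [DecidableEq ι] [Field k] [Field K]
  [Algebra k K]

omit [Finite V] in
theorem Finset.exists_injOn_of_card_le {S : Finset ι} {W : Finset V} (h : S.card ≤ W.card)
    {j₀ : ι} {w : V} (hj₀ : j₀ ∈ S) (hw : w ∈ W) :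
    ∃ v : ι → V, Set.InjOn v S ∧ (∀ j ∈ S, v j ∈ W) ∧ v j₀ = w := by
  obtain ⟨e⟩ := Function.Embedding.nonempty_of_card_le (α := S.erase j₀) (β := W.erase w) (by
    rw [Fintype.card_coe, Fintype.card_coe, Finset.card_erase_of_mem hj₀,
      Finset.card_erase_of_mem hw]
    omega)
  refine ⟨fun j => if hj : j ∈ S.erase j₀ then e ⟨j, hj⟩ else w, fun j hj j' hj' h => ?_,
    fun j hj => ?_, by simp⟩
  · have hne (x : W.erase w) : (x : V) ≠ w := (Finset.mem_erase.1 x.2).1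
    by_cases h1 : j = j₀ <;> by_cases h2 : j' = j₀
    · rw [h1, h2]
    · simp only [h1, Finset.mem_erase, h2, Finset.mem_coe.1 hj', ne_eq, not_true, false_and,
        dite_false, not_false_eq_true, true_and, dite_true] at h
      exact absurd h.symm (hne _)
    · simp only [h1, Finset.mem_erase, h2, Finset.mem_coe.1 hj, ne_eq, not_true, false_and,
        dite_false, not_false_eq_true, true_and, dite_true] at h
      exact absurd h (hne _)
    · simp only [h1, Finset.mem_erase, h2, Finset.mem_coe.1 hj, Finset.mem_coe.1 hj', ne_eq,
        not_false_eq_true, true_and, dite_true] at h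
      exact congrArg Subtype.val (e.injective (Subtype.ext h))
  · dsimp only
    split_ifs with h1
    · exact (Finset.mem_erase.1 (e ⟨j, h1⟩).2).2
    · exact hw

variable {c : ℕ → V → K} (hc : AlgebraicIndependent k fun p : ℕ × V => c p.1 p.2)
  {S : Finset ι} {W : Finset V} {T : ι → Finset ℕ}
include hc

theorem koszulSyzygies_prodForm (hSW : S.card ≤ W.card)
    (hT : (S : Set ι).PairwiseDisjoint T) (i : ℕ) :
    KoszulSyzygies S (fun j => prodForm W c (T j)) (fun j => (T j).card) i := by
  obtain rfl | ⟨j₀, hj₀⟩ := S.eq_empty_or_nonempty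
  · exact fun q _ _ => ⟨0, by simp⟩
  obtain ⟨w, hw⟩ : W.Nonempty := by
    rw [← Finset.card_pos]
    exact (Finset.card_pos.2 ⟨j₀, hj₀⟩).trans_le hSW
  obtain ⟨v, hv, hvW, -⟩ := Finset.exists_injOn_of_card_le hSW hj₀ hw
  exact koszulSyzygies_replaceRows hc hv hvW hT ∅ w (by simp) i

theorem koszulSyzygies_replaceRow (hSW : S.card ≤ W.card)
    (hT : (S : Set ι).PairwiseDisjoint T) {j₀ : ι} {w : V} (hj₀ : j₀ ∈ S) (hw : w ∈ W)
    {s : ℕ} (hs : s ∈ T j₀) (i : ℕ) :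
    KoszulSyzygies S (fun j => prodForm W (replaceRows {s} w c) (T j))
      (fun j => (T j).card) i := by
  obtain ⟨v, hv, hvW, hvw⟩ := Finset.exists_injOn_of_card_le hSW hj₀ hw
  refine koszulSyzygies_replaceRows hc hv hvW hT {s} w (fun s' hs' j hj hsj => ?_) i
  rw [Finset.mem_singleton.1 hs'] at hsj
  have : j = j₀ := by
    by_contra hne
    exact Finset.disjoint_left.1 (hT hj hj₀ hne) hsj hs
  rw [this, hvw]

omit hc [Finite V] [DecidableEq ι] in
theorem linForm_replaceRows_self {w : V} (hw : w ∈ W) (s : ℕ) :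
    linForm W (replaceRows {s} w c) s = X w :=
  linForm_indicator hw fun v _ => by simp [replaceRows]

omit hc [Finite V] [DecidableEq ι] in
theorem prodForm_replaceRows_of_notMem {w : V} {s : ℕ} {t : Finset ℕ} (hs : s ∉ t) :
    prodForm W (replaceRows {s} w c) t = prodForm W c t :=
  prodForm_congr fun s' hs' v _ => by
    have : s' ≠ s := fun h => hs (h ▸ hs')
    simp [replaceRows, this]

/-- The variable `w` is a nonzerodivisor modulo fewer than `|W|` generic products of linear
forms. -/
theorem mem_span_prodForm_of_X_mul_mem (hSW : S.card ≤ W.card)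
    (hT : (S : Set ι).PairwiseDisjoint T) {j₀ : ι} {w : V} (hj₀ : j₀ ∈ S) (hw : w ∈ W)
    {s : ℕ} (hs : s ∈ T j₀) {y : MvPolynomial V K}
    (hy : X w * y ∈ Ideal.span ((fun j => prodForm W c (T j)) '' (S.erase j₀ : Finset ι))) :
    y ∈ Ideal.span ((fun j => prodForm W c (T j)) '' (S.erase j₀ : Finset ι)) := by
  let T' := Function.update T j₀ {s}
  have hT'le : ∀ j, T' j ⊆ T j := by
    intro j
    by_cases h : j = j₀
    · subst h
      simpa [T'] using hs
    · simp [T', h]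
  have hT' : (S : Set ι).PairwiseDisjoint T' := hT.mono_on fun j _ => hT'le j
  let f : ι → MvPolynomial V K := fun j => prodForm W (replaceRows {s} w c) (T' j)
  have himg : f '' (S.erase j₀ : Finset ι) =
      (fun j => prodForm W c (T j)) '' (S.erase j₀ : Finset ι) := by
    refine Set.image_congr fun j hj => ?_
    obtain ⟨hne, hjS⟩ := Finset.mem_erase.1 (Finset.mem_coe.1 hj)
    have hTj : T' j = T j := Function.update_of_ne hne _ _
    change prodForm W (replaceRows {s} w c) (T' j) = _
    rw [hTj, prodForm_replaceRows_of_notMem]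
    exact fun hsj => Finset.disjoint_left.1 (hT hjS hj₀ hne) hsj hs
  have hf₀ : f j₀ = X w := by
    change prodForm W (replaceRows {s} w c) (T' j₀) = _
    rw [show T' j₀ = {s} from Function.update_self _ _ _, prodForm, Finset.prod_singleton,
      linForm_replaceRows_self hw]
  rw [← himg, ← hf₀] at hy
  rw [← himg]
  refine KoszulSyzygies.mem_of_mul_mem (d := fun j => (T' j).card) (S.notMem_erase j₀)
    (fun j _ => prodForm_isHomogeneous _ _ _) (fun i => ?_) hy
  rw [Finset.insert_erase hj₀]
  exact koszulSyzygies_replaceRow hc hSW hT' hj₀ hw (by simp [T']) i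

theorem mem_span_prodForm_of_special {g j₀ : ι} (hg : g ∉ S) (hSW : S.card ≤ W.card)
    (hT : ((insert g S : Finset ι) : Set ι).PairwiseDisjoint T) {w : V} (hj₀ : j₀ ∈ S)
    (hw : w ∈ W) {s u : ℕ} (hs : s ∈ T j₀) (hu : u ∈ T g) (a : ℕ) (t : K)
    (H : ∀ p : MvPolynomial V K, p.IsHomogeneous a →
      (X w + C t * linForm W c u) * prodForm W c ((T g).erase u) * p ∈
        Ideal.span ((fun j => prodForm W (replaceRows {s} w c) (T j)) '' (S : Set ι)) →
      p ∈ Ideal.span ((fun j => prodForm W (replaceRows {s} w c) (T j)) '' (S : Set ι)))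
    {p : MvPolynomial V K} (hp : p.IsHomogeneous a)
    (hmem : prodForm W c (T g) * p ∈ Ideal.span ((fun j => prodForm W c (T j)) '' (S : Set ι))) :
    p ∈ Ideal.span ((fun j => prodForm W c (T j)) '' (S : Set ι)) := by
  have hTS : (S : Set ι).PairwiseDisjoint T := hT.subset (by simp)
  have hgj : ∀ j ∈ S, Disjoint (T g) (T j) := fun j hj =>
    hT (by simp) (by simp [hj]) fun h => hg (h ▸ hj)
  let c' : ℕ → V → K := fun r v =>
    if r = u then (if v = w then 1 else 0) + t * c u v else replaceRows {s} w c r v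
  have hgen := KoszulSyzygies.of_specialization (S := insert g S)
    (f := fun j => prodForm W (fun s v => (X (s, v) : MvPolynomial (ℕ × V) k)) (T j))
    (d := fun j => (T j).card) (i := a + (T g).card)
    (fun j _ => prodForm_isHomogeneous _ _ _)
    (aeval (R := k) fun p : ℕ × V => c' p.1 p.2).toRingHom
    (aeval (R := k) fun p : ℕ × V => c p.1 p.2).toRingHom hc
  simp only [map_prodForm, AlgHom.toRingHom_eq_coe, RingHom.coe_coe, aeval_X] at hgen
  refine (hgen ?_).mem_of_colon (d := fun j => (T j).card) hg
    (fun j _ => prodForm_isHomogeneous _ _ _) (shiftComponent_of_isHomogeneous rfl hp) hmem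
  have hc'S : ∀ j ∈ S, prodForm W c' (T j) = prodForm W (replaceRows {s} w c) (T j) :=
    fun j hj => prodForm_congr fun r hr v _ => if_neg fun h =>
      Finset.disjoint_left.1 (hgj j hj) (h ▸ hu) hr
  have hc'g : prodForm W c' (T g) =
      (X w + C t * linForm W c u) * prodForm W c ((T g).erase u) := by
    rw [prodForm_erase hu]
    congr 1
    · rw [← linForm_indicator (b := fun _ v => if v = w then (1 : K) else 0) (s := u) hw
        (fun _ _ => rfl), linForm, linForm, linForm, Finset.mul_sum, ← Finset.sum_add_distrib]
      refine Finset.sum_congr rfl fun v _ => ?_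
      simp only [c', if_true, C_add, C_mul]
      ring
    · refine prodForm_congr fun r hr v _ => ?_
      have hrs : r ≠ s := fun h =>
        Finset.disjoint_left.1 (hgj j₀ hj₀) (Finset.mem_of_mem_erase hr) (h ▸ hs)
      simp [c', (Finset.mem_erase.1 hr).1, replaceRows, hrs]
  have himg : (fun j => prodForm W c' (T j)) '' (S : Set ι) =
      (fun j => prodForm W (replaceRows {s} w c) (T j)) '' (S : Set ι) :=
    Set.image_congr hc'S
  refine KoszulSyzygies.insert_of_colon hg (fun j _ => prodForm_isHomogeneous _ _ _)
    ((koszulSyzygies_replaceRow hc hSW hTS hj₀ hw hs _).congr fun j hj => (hc'S j hj).symm)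
    fun q hq hqm => ?_
  rw [himg] at hqm ⊢
  refine H q ?_ (by rwa [← hc'g])
  rw [← hq]
  exact shiftComponent_isHomogeneous _ _ _ rfl _

end rows

section killVar

variable {V R : Type*} [CommRing R] [DecidableEq V]

/-- Setting the variable `w` to zero. -/
noncomputable def killVar (w : V) : MvPolynomial V R →ₐ[R] MvPolynomial V R :=
  aeval fun v => if v = w then 0 else X v

theorem exists_eq_killVar_add (w : V) (p : MvPolynomial V R) :
    ∃ y, p = killVar w p + X w * y := by
  have h : (Ideal.Quotient.mkₐ R (Ideal.span {(X w : MvPolynomial V R)})).comp (killVar w) =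
      Ideal.Quotient.mkₐ R (Ideal.span {(X w : MvPolynomial V R)}) := by
    ext v
    by_cases hv : v = w
    · subst hv
      simp only [killVar, AlgHom.comp_apply, aeval_X, if_true, map_zero]
      exact (Ideal.Quotient.eq_zero_iff_mem.2 (Ideal.mem_span_singleton_self _)).symm
    · simp [killVar, hv]
  have h' : Ideal.Quotient.mk (Ideal.span {(X w : MvPolynomial V R)}) p =
      Ideal.Quotient.mk _ (killVar w p) := (AlgHom.congr_fun h p).symm
  obtain ⟨y, hy⟩ := Ideal.mem_span_singleton'.1 (Ideal.Quotient.eq.1 h')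
  exact ⟨y, by rw [mul_comm, hy]; ring⟩

theorem killVar_X_self (w : V) : killVar w (X w : MvPolynomial V R) = 0 := by
  simp [killVar]

theorem killVar_isHomogeneous (w : V) {p : MvPolynomial V R} {a : ℕ} (hp : p.IsHomogeneous a) :
    (killVar w p).IsHomogeneous a := by
  have := hp.aeval (fun v => if v = w then (0 : MvPolynomial V R) else X v) (n := 1)
    fun v => by
      split_ifs
      · exact isHomogeneous_zero _ _ _
      · exact isHomogeneous_X _ _
  rwa [one_mul] at this

theorem killVar_prodForm (w : V) (W : Finset V) (b : ℕ → V → R) (t : Finset ℕ) :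
    killVar w (prodForm W b t) = prodForm (W.erase w) b t := by
  rw [prodForm, map_prod, prodForm]
  refine Finset.prod_congr rfl fun s _ => ?_
  rw [linForm, map_sum, linForm, ← Finset.sum_erase W (a := w) (by simp [killVar])]
  refine Finset.sum_congr rfl fun v hv => ?_
  simp [killVar, (Finset.mem_erase.1 hv).1]

theorem killVar_mem_span {ι : Type*} {S : Finset ι} {f f' : ι → MvPolynomial V R} {w : V}
    (h : ∀ j ∈ S, killVar w (f j) = f' j) {x : MvPolynomial V R}
    (hx : x ∈ Ideal.span (f '' (S : Set ι))) :
    killVar w x ∈ Ideal.span (f' '' (S : Set ι)) := by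
  obtain ⟨r, rfl⟩ := mem_span_image_iff_exists_sum.1 hx
  rw [map_sum]
  refine sum_mem fun j hj => ?_
  rw [map_mul, h j hj]
  exact Ideal.mul_mem_right _ _ (Ideal.subset_span ⟨j, hj, rfl⟩)

end killVar

theorem mem_span_prodForm_of_mul_mem {V ι K k : Type*} [Finite V] [DecidableEq V]
    [DecidableEq ι] [Field k] [Field K] [Infinite K] [Algebra k K] {c : ℕ → V → K}
    (hc : AlgebraicIndependent k fun p : ℕ × V => c p.1 p.2) (N m : ℕ)
    {S : Finset ι} {W : Finset V} {T : ι → Finset ℕ} {g : ι} {a : ℕ} {p : MvPolynomial V K}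
    (hW : W.card = N) (hS : S.card = N) (hg : g ∉ S)
    (hT : ((insert g S : Finset ι) : Set ι).PairwiseDisjoint T) (hm : (T g).card = m)
    (hp : p.IsHomogeneous a) (hle : 2 * a + m + N ≤ ∑ j ∈ S, (T j).card)
    (hmem : prodForm W c (T g) * p ∈ Ideal.span ((fun j => prodForm W c (T j)) '' (S : Set ι))) :
    p ∈ Ideal.span ((fun j => prodForm W c (T j)) '' (S : Set ι)) := by
  induction N generalizing m S W T g a p with
  | zero =>
    obtain rfl := Finset.card_eq_zero.1 hS
    have : T g = ∅ := Finset.card_eq_zero.1 (by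
      rw [Finset.sum_empty] at hle
      omega)
    rwa [this, prodForm_empty, one_mul] at hmem
  | succ N IH =>
  induction m generalizing T a p with
  | zero =>
    rw [Finset.card_eq_zero] at hm
    rwa [hm, prodForm_empty, one_mul] at hmem
  | succ m ihm =>
  obtain ⟨w, hw⟩ : W.Nonempty := Finset.card_pos.1 (by omega)
  obtain ⟨j₀, hj₀⟩ : S.Nonempty := Finset.card_pos.1 (by omega)
  obtain ⟨u, hu⟩ : (T g).Nonempty := Finset.card_pos.1 (by omega)
  obtain h₀ | ⟨s, hs⟩ := (T j₀).eq_empty_or_nonempty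
  · have : (1 : MvPolynomial V K) ∈ Ideal.span ((fun j => prodForm W c (T j)) '' (S : Set ι)) :=
      Ideal.subset_span ⟨j₀, hj₀, by simp only [h₀, prodForm_empty]⟩
    rw [(Ideal.eq_top_iff_one _).2 this]
    trivial
  have hgj₀ : j₀ ≠ g := fun h => hg (h ▸ hj₀)
  have hne : ∀ j ∈ S.erase j₀, j ≠ j₀ ∧ j ∈ S ∧ j ≠ g := fun j hj =>
    ⟨(Finset.mem_erase.1 hj).1, (Finset.mem_erase.1 hj).2, fun h =>
      hg (h ▸ (Finset.mem_erase.1 hj).2)⟩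
  have hTS : (S : Set ι).PairwiseDisjoint T := hT.subset (by simp)
  have hSW : S.card ≤ W.card := (hS.trans hW.symm).le
  set W' := W.erase w with hW'
  set F : ι → MvPolynomial V K := fun j => prodForm W c (T j) with hF
  set F' : ι → MvPolynomial V K := fun j => prodForm W' c (T j) with hF'
  set I' := Ideal.span (F '' (S.erase j₀ : Finset ι)) with hI'
  set J' := Ideal.span (F' '' (S.erase j₀ : Finset ι)) with hJ'
  set f₁ := prodForm W c ((T j₀).erase s) with hf₁
  set g₁ := prodForm W c ((T g).erase u) with hg₁
  set l := linForm W c u with hl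
  -- the special point
  set I := Ideal.span ((fun j => prodForm W (replaceRows {s} w c) (T j)) '' (S : Set ι)) with hI
  have hIspan : I = Ideal.span (insert (X w * f₁) (F '' (S.erase j₀ : Finset ι))) := by
    rw [hI, ← Finset.insert_erase hj₀, Finset.coe_insert, Set.image_insert_eq,
      Finset.erase_insert (S.notMem_erase j₀)]
    congr 2
    · rw [prodForm_erase hs, linForm_replaceRows_self hw,
        prodForm_replaceRows_of_notMem ((T j₀).notMem_erase s)]
    · refine Set.image_congr fun j hj => prodForm_replaceRows_of_notMem fun hsj => ?_
      obtain ⟨h1, h2, -⟩ := hne j hj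
      exact Finset.disjoint_left.1 (hTS h2 hj₀ h1) hsj hs
  have hI'I : I' ≤ I := hIspan ▸ Ideal.span_mono (Set.subset_insert _ _)
  have hXI : X w * f₁ ∈ I := hIspan ▸ Ideal.subset_span (Set.mem_insert _ _)
  have hkill : ∀ x ∈ I', killVar w x ∈ J' := fun x hx =>
    killVar_mem_span (fun j _ => killVar_prodForm w W c (T j)) hx
  have hJ'I : ∀ x ∈ J', f₁ * x ∈ I := by
    intro x hx
    obtain ⟨r, rfl⟩ := mem_span_image_iff_exists_sum.1 hx
    rw [Finset.mul_sum]
    refine sum_mem fun j hj => ?_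
    obtain ⟨y, hy⟩ := exists_eq_killVar_add w (F j)
    rw [show killVar w (F j) = F' j from killVar_prodForm w W c (T j)] at hy
    have e : f₁ * (F' j * r j) = f₁ * r j * F j - y * r j * (X w * f₁) := by
      rw [hy]
      ring
    rw [e]
    exact sub_mem (Ideal.mul_mem_left _ _ (hI'I (Ideal.subset_span ⟨j, hj, rfl⟩)))
      (Ideal.mul_mem_left _ _ hXI)
  obtain ⟨t, ht⟩ := Ideal.exists_add_C_mul_mul_mem I (X w * g₁) (l * g₁) a (by
    intro p₀ p₁ hp₀ _ h₀ h₁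
    have h₂ : ∃ y, g₁ * p₀ + y * f₁ ∈ I' := by
      rw [hIspan, Ideal.mem_span_insert'] at h₀
      obtain ⟨y, hy⟩ := h₀
      refine ⟨y, mem_span_prodForm_of_X_mul_mem hc hSW hTS hj₀ hw hs ?_⟩
      convert hy using 1
      ring
    let T₁ := Function.update (Function.update T j₀ ((T j₀).erase s)) g ((T g).erase u)
    have hT₁g : T₁ g = (T g).erase u := Function.update_self _ _ _
    have hT₁j₀ : T₁ j₀ = (T j₀).erase s := by
      simp [T₁, hgj₀]
    have hT₁ : ∀ j ∈ S.erase j₀, T₁ j = T j := fun j hj => by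
      obtain ⟨h1, -, h2⟩ := hne j hj
      simp [T₁, h1, h2]
    have hT₁T : ∀ j, T₁ j ⊆ T j := by
      intro j
      by_cases h1 : j = g
      · rw [h1, hT₁g]
        exact Finset.erase_subset _ _
      by_cases h2 : j = j₀
      · rw [h2, hT₁j₀]
        exact Finset.erase_subset _ _
      simp [T₁, h1, h2]
    have himg : (fun j => prodForm W c (T₁ j)) '' (S : Set ι) =
        insert f₁ (F '' (S.erase j₀ : Finset ι)) := by
      rw [← Finset.insert_erase hj₀, Finset.coe_insert, Set.image_insert_eq,
        Finset.erase_insert (S.notMem_erase j₀)]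
      congr 1
      · rw [hT₁j₀]
      · exact Set.image_congr fun j hj => by rw [hT₁ j hj]
    have hsum := Finset.add_sum_erase S (fun j => (T j).card) hj₀
    have hsum₁ := Finset.add_sum_erase S (fun j => (T₁ j).card) hj₀
    rw [Finset.sum_congr rfl fun j hj => by rw [hT₁ j hj], hT₁j₀] at hsum₁
    have hcs := Finset.card_erase_add_one hs
    have hcu := Finset.card_erase_add_one hu
    have h₃ := ihm (T := T₁) (hT.mono_on fun j _ => hT₁T j) (by rw [hT₁g]; omega) hp₀
      (by omega) (by
        rw [himg, Ideal.mem_span_insert', hT₁g]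
        exact h₂)
    obtain ⟨r, hr, hpr⟩ := exists_shiftComponent_sum (d := fun j => (T₁ j).card) (i := a)
      (e := 0) (fun j _ => prodForm_isHomogeneous _ _ _) h₃
    rw [shiftComponent_of_isHomogeneous (add_zero a) hp₀, ← Finset.add_sum_erase S _ hj₀, hT₁j₀,
      Finset.sum_congr rfl fun j hj => by rw [hT₁ j hj]] at hpr
    replace hpr : p₀ = f₁ * r j₀ + ∑ j ∈ S.erase j₀, F j * r j := hpr
    have hrest : ∑ j ∈ S.erase j₀, F j * r j ∈ I' := mem_span_image_iff_exists_sum.2 ⟨r, rfl⟩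
    have h₄ : killVar w (r j₀) ∈ J' := by
      have hr₀ := hr j₀
      simp only [hT₁j₀, zero_add] at hr₀
      rcases lt_or_ge a ((T j₀).erase s).card with hlt | hge
      · rw [← hr₀, shiftComponent_of_lt hlt, map_zero]
        exact zero_mem _
      have hr₁ : (r j₀).IsHomogeneous (a - ((T j₀).erase s).card) := by
        rw [← hr₀]
        exact shiftComponent_isHomogeneous _ _ _ (by omega) _
      let T₂ := Function.update T g (T g ∪ (T j₀).erase s)
      have hT₂g : T₂ g = T g ∪ (T j₀).erase s := Function.update_self _ _ _
      have hT₂ : ∀ j ∈ S.erase j₀, T₂ j = T j := fun j hj =>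
        Function.update_of_ne (hne j hj).2.2 _ _
      have hdis : Disjoint (T g) ((T j₀).erase s) :=
        (hT (by simp) (by simp [hj₀]) hgj₀.symm).mono_right (Finset.erase_subset _ _)
      have hgdis : ∀ j ∈ S.erase j₀, Disjoint (T₂ g) (T₂ j) := by
        intro j hj
        obtain ⟨h1, h2, h3⟩ := hne j hj
        rw [hT₂g, hT₂ j hj, Finset.disjoint_union_left]
        exact ⟨hT (by simp) (by simp [h2]) h3.symm,
          (hTS hj₀ h2 h1.symm).mono_left (Finset.erase_subset _ _)⟩
      have himg₂ : (fun j => prodForm W' c (T₂ j)) '' (S.erase j₀ : Finset ι) =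
          F' '' (S.erase j₀ : Finset ι) := Set.image_congr fun j hj => by rw [hT₂ j hj]
      have hcard : (T₂ g).card = m + 1 + ((T j₀).erase s).card := by
        rw [hT₂g, Finset.card_union_of_disjoint hdis, hm]
      have h₅ := IH (m + 1 + ((T j₀).erase s).card) (S := S.erase j₀) (W := W') (T := T₂)
        (g := g) (p := killVar w (r j₀)) (a := a - ((T j₀).erase s).card)
        (by rw [hW', Finset.card_erase_of_mem hw, hW]; rfl)
        (by rw [Finset.card_erase_of_mem hj₀, hS]; rfl)
        (fun h => hg (Finset.mem_of_mem_erase h))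
        (by
          intro i hi j hj hij
          rcases Finset.mem_insert.1 hi with rfl | hi' <;>
            rcases Finset.mem_insert.1 hj with rfl | hj'
          · exact absurd rfl hij
          · exact hgdis j hj'
          · exact (hgdis i hi').symm
          · change Disjoint (T₂ i) (T₂ j)
            rw [hT₂ i hi', hT₂ j hj']
            exact hTS (hne i hi').2.1 (hne j hj').2.1 hij)
        hcard (killVar_isHomogeneous w hr₁)
        (by
          rw [Finset.sum_congr rfl fun j hj => by rw [hT₂ j hj]]
          omega)
        (by
          rw [himg₂, hT₂g, prodForm_union hdis, prodForm_erase hu]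
          rw [hIspan, Ideal.mem_span_insert'] at h₁
          obtain ⟨y, hy⟩ := h₁
          have h₆ := hkill _ hy
          have h₇ := hkill _ hrest
          rw [hpr] at h₆
          simp only [map_add, map_mul, killVar_X_self, zero_mul, mul_zero, add_zero] at h₆
          rw [hf₁, hg₁, killVar_prodForm, killVar_prodForm] at h₆
          have e : killVar w l = linForm W' c u := by
            have := killVar_prodForm w W c {u}
            simpa [prodForm] using this
          rw [e] at h₆
          have h₈ := sub_mem h₆ (Ideal.mul_mem_left J'
            (linForm W' c u * prodForm W' c ((T g).erase u)) h₇)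
          convert h₈ using 1
          ring)
      rwa [himg₂] at h₅
    obtain ⟨y, hy⟩ := exists_eq_killVar_add w (r j₀)
    rw [hpr]
    refine add_mem ?_ (hI'I hrest)
    rw [hy, mul_add]
    refine add_mem (hJ'I _ h₄) ?_
    rw [← mul_assoc, mul_comm f₁]
    exact Ideal.mul_mem_right _ _ hXI)
  refine mem_span_prodForm_of_special hc hg hSW hT hj₀ hw hs hu a t (fun q hq hqm => ?_) hp hmem
  refine ht q hq ?_
  convert hqm using 1
  ring

section generic

theorem map_killVar {V R A : Type*} [CommRing R] [CommRing A] [DecidableEq V] (χ : R →+* A)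
    (w : V) (p : MvPolynomial V R) : map χ (killVar w p) = killVar w (map χ p) := by
  induction p using MvPolynomial.induction_on with
  | C r => simp [killVar]
  | add p q hp hq => simp only [map_add, hp, hq]
  | mul_X p v hp =>
    simp only [map_mul, hp, map_X]
    by_cases hv : v = w <;> simp [killVar, hv]

theorem shiftComponent_killVar {V R : Type*} [CommRing R] [DecidableEq V] {i d : ℕ}
    (w : V) {q : MvPolynomial V R} (hq : shiftComponent i d q = q) :
    shiftComponent i d (killVar w q) = killVar w q := by
  rcases lt_or_ge i d with h | h
  · rw [shiftComponent_of_lt h] at hq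
    rw [← hq, map_zero, shiftComponent_of_lt h]
  · have : q.IsHomogeneous (i - d) := by
      rw [← hq]
      exact shiftComponent_isHomogeneous _ _ _ (by omega) _
    exact shiftComponent_of_isHomogeneous (by omega) (killVar_isHomogeneous w this)

/-- If the restrictions of the `f j` to `x_w = 0` have only Koszul syzygies in degree `i`, then
multiplication by `x_w` is injective modulo the `f j` from degree `i - 1` to degree `i`. -/
theorem KoszulSyzygies.mem_of_X_mul_mem {V ι R : Type*} [CommRing R] [DecidableEq V]
    [DecidableEq ι] {S : Finset ι} {f : ι → MvPolynomial V R} {d : ι → ℕ}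
    (hf : ∀ j ∈ S, (f j).IsHomogeneous (d j)) {w : V} {i : ℕ}
    (H : KoszulSyzygies S (fun j => killVar w (f j)) d i) {p : MvPolynomial V R}
    (hp : shiftComponent i 1 p = p) (hmem : X w * p ∈ Ideal.span (f '' (S : Set ι))) :
    p ∈ Ideal.span (f '' (S : Set ι)) := by
  obtain ⟨q, hq, hpq⟩ := exists_shiftComponent_sum hf (i := i) (e := 0) hmem
  rw [shiftComponent_mul (isHomogeneous_X R w), zero_add, hp] at hpq
  simp only [zero_add] at hq
  obtain ⟨h, hh⟩ := H (fun j => killVar w (q j)) (fun j _ => shiftComponent_killVar w (hq j))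
    (by
      have := congrArg (killVar w) hpq
      simpa [map_sum, killVar_X_self] using this.symm)
  choose y hy using fun j => exists_eq_killVar_add w (q j)
  choose z hz using fun j => exists_eq_killVar_add w (f j)
  have hqj : ∀ j ∈ S, q j = ∑ k ∈ S, (h j k - h k j) * f k +
      X w * (y j - ∑ k ∈ S, (h j k - h k j) * z k) := by
    intro j hj
    rw [hy j, hh j hj, mul_sub, Finset.mul_sum, add_sub, add_sub_right_comm,
      ← Finset.sum_sub_distrib]
    congr 1
    refine Finset.sum_congr rfl fun k _ => ?_
    linear_combination (h k j - h j k) * hz k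
  have key : X w * p = X w * ∑ j ∈ S, f j * (y j - ∑ k ∈ S, (h j k - h k j) * z k) := by
    rw [hpq, ← zero_add (X w * _), ← sum_koszul_eq_zero S f h, Finset.mul_sum,
      ← Finset.sum_add_distrib]
    refine Finset.sum_congr rfl fun j hj => ?_
    rw [hqj j hj]
    ring
  have : p = ∑ j ∈ S, f j * (y j - ∑ k ∈ S, (h j k - h k j) * z k) :=
    isRegular_X.left key
  exact mem_span_image_iff_exists_sum.2 ⟨_, this⟩

theorem koszulSyzygies_univ_prodForm {V ι K k : Type*} [Fintype V] [DecidableEq V] [Fintype ι]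
    [DecidableEq ι] [Field k] [Field K] [Infinite K] [Algebra k K] {c : ℕ → V → K}
    (hc : AlgebraicIndependent k fun p : ℕ × V => c p.1 p.2)
    (hcard : Fintype.card ι = Fintype.card V) (w : V) {T : ι → Finset ℕ}
    (hT : Pairwise fun j j' => Disjoint (T j) (T j')) {i : ℕ}
    (hi : 2 * i + Fintype.card V ≤ ∑ j, (T j).card + 1) :
    KoszulSyzygies Finset.univ (fun j => prodForm (Finset.univ.erase w) c (T j))
      (fun j => (T j).card) i := by
  have hpos : 0 < Fintype.card V := Fintype.card_pos_iff.2 ⟨w⟩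
  obtain ⟨g⟩ : Nonempty ι := Fintype.card_pos_iff.1 (hcard ▸ hpos)
  have hW : (Finset.univ.erase w).card = Fintype.card V - 1 := by
    rw [Finset.card_erase_of_mem (Finset.mem_univ _), Finset.card_univ]
  have hS : (Finset.univ.erase g).card = Fintype.card V - 1 := by
    rw [Finset.card_erase_of_mem (Finset.mem_univ _), Finset.card_univ, hcard]
  have hT' (s : Set ι) : s.PairwiseDisjoint T := fun j _ j' _ h => hT h
  rw [← Finset.insert_erase (Finset.mem_univ g)]
  refine KoszulSyzygies.insert_of_colon (Finset.notMem_erase _ _)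
    (fun j _ => prodForm_isHomogeneous _ _ _)
    (koszulSyzygies_prodForm hc (hS.trans hW.symm).le (hT' _) i) fun p hp hmem => ?_
  rcases lt_or_ge i (T g).card with h | h
  · rw [← hp, shiftComponent_of_lt h]
    exact zero_mem _
  have hpa : p.IsHomogeneous (i - (T g).card) := by
    rw [← hp]
    exact shiftComponent_isHomogeneous _ _ _ (by omega) _
  have hsum := Finset.add_sum_erase Finset.univ (fun j => (T j).card) (Finset.mem_univ g)
  exact mem_span_prodForm_of_mul_mem hc _ _ hW hS (Finset.notMem_erase _ _) (hT' _) rfl hpa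
    (by omega) hmem

/-- The form of degree `a` whose coefficients are prescribed by `u`. -/
noncomputable def formOfCoeffs {V R : Type*} [Fintype V] [CommRing R] (a : ℕ)
    (u : { μ : V →₀ ℕ // μ.degree = a } → R) : MvPolynomial V R :=
  ∑ μ ∈ (Finsupp.finite_of_degree_le (σ := V) a).toFinset,
    if h : μ.degree = a then monomial μ (u ⟨μ, h⟩) else 0

theorem coeff_formOfCoeffs {V R : Type*} [Fintype V] [CommRing R] (a : ℕ)
    (u : { μ : V →₀ ℕ // μ.degree = a } → R) (μ : V →₀ ℕ) :
    coeff μ (formOfCoeffs a u) = if h : μ.degree = a then u ⟨μ, h⟩ else 0 := by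
  classical
  rw [formOfCoeffs, coeff_sum, Finset.sum_eq_single μ]
  · split_ifs <;> simp
  · intro ν _ hν
    split_ifs <;> simp [coeff_monomial, hν]
  · intro h
    rw [dif_neg fun hμ => h (by simp [hμ]), coeff_zero]

theorem formOfCoeffs_isHomogeneous {V R : Type*} [Fintype V] [CommRing R] (a : ℕ)
    (u : { μ : V →₀ ℕ // μ.degree = a } → R) : (formOfCoeffs a u).IsHomogeneous a := by
  refine IsHomogeneous.sum _ _ _ fun μ _ => ?_
  split_ifs with h
  · exact isHomogeneous_monomial _ h
  · exact isHomogeneous_zero _ _ _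

theorem map_formOfCoeffs_of_isHomogeneous {V R A : Type*} [Fintype V] [CommRing R] [CommRing A]
    {a : ℕ} {u : { μ : V →₀ ℕ // μ.degree = a } → R} {χ : R →+* A} {p : MvPolynomial V A}
    (hp : p.IsHomogeneous a) (hχ : ∀ μ, χ (u μ) = coeff μ.1 p) :
    map χ (formOfCoeffs a u) = p := by
  ext μ
  rw [coeff_map, coeff_formOfCoeffs]
  split_ifs with h
  · exact hχ ⟨μ, h⟩
  · rw [map_zero, hp.coeff_eq_zero h]

theorem koszulSyzygies_killVar_of_algebraicIndependent {F K V ι : Type*} [Field F] [Field K]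
    [Algebra F K] [Fintype V] [DecidableEq V] [Fintype ι] [DecidableEq ι] {d : ι → ℕ}
    {f : ι → MvPolynomial V K} (hf : ∀ j, (f j).IsHomogeneous (d j))
    (halg : AlgebraicIndependent F
      fun p : Σ j : ι, { μ : V →₀ ℕ // μ.degree = d j } => (f p.1).coeff p.2.1)
    (hcard : Fintype.card ι = Fintype.card V) (w : V) {i : ℕ}
    (hi : 2 * i + Fintype.card V ≤ ∑ j, d j + 1) :
    KoszulSyzygies Finset.univ (fun j => killVar w (f j)) d i := by
  let L := FractionRing (MvPolynomial (ℕ × V) F)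
  let c : ℕ → V → L := fun s v => algebraMap (MvPolynomial (ℕ × V) F) L (X (s, v))
  have hLinj : Function.Injective (algebraMap (MvPolynomial (ℕ × V) F) L) :=
    IsFractionRing.injective _ _
  have hc : AlgebraicIndependent F fun p : ℕ × V => c p.1 p.2 :=
    (MvPolynomial.algebraicIndependent_X (ℕ × V) F).map'
      (f := IsScalarTower.toAlgHom F (MvPolynomial (ℕ × V) F) L) hLinj
  have : Infinite L := Infinite.of_injective (fun s : ℕ => c s w) fun s s' h =>
    congrArg Prod.fst (X_injective (hLinj h))
  obtain ⟨e⟩ : Nonempty (ι ↪ ℕ) := ⟨(Fintype.equivFin ι).toEmbedding.trans Fin.valEmbedding⟩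
  let T : ι → Finset ℕ := fun j => (Finset.range (d j)).image (Nat.pair (e j))
  have hTcard (j : ι) : (T j).card = d j := by
    rw [Finset.card_image_of_injective, Finset.card_range]
    intro a b h
    exact (Nat.pair_eq_pair.1 h).2
  have hT : Pairwise fun j j' => Disjoint (T j) (T j') := by
    intro j j' hjj
    rw [Finset.disjoint_left]
    intro s hs hs'
    obtain ⟨a, -, rfl⟩ := Finset.mem_image.1 hs
    obtain ⟨b, -, hb⟩ := Finset.mem_image.1 hs'
    exact hjj (e.injective (Nat.pair_eq_pair.1 hb).1.symm)
  have hspecial := koszulSyzygies_univ_prodForm hc hcard w hT (i := i) (by simpa only [hTcard])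
  simp only [hTcard] at hspecial
  -- the universal forms
  let U : ι → MvPolynomial V (MvPolynomial (Σ j : ι, { μ : V →₀ ℕ // μ.degree = d j }) F) :=
    fun j => formOfCoeffs (d j) fun μ => X ⟨j, μ⟩
  have key := KoszulSyzygies.of_specialization (S := Finset.univ) (f := fun j => killVar w (U j))
    (d := d) (i := i) (fun j _ => killVar_isHomogeneous w (formOfCoeffs_isHomogeneous _ _))
    (aeval fun p : Σ j : ι, { μ : V →₀ ℕ // μ.degree = d j } =>
      coeff p.2.1 (prodForm Finset.univ c (T p.1))).toRingHom
    (aeval fun p : Σ j : ι, { μ : V →₀ ℕ // μ.degree = d j } =>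
      coeff p.2.1 (f p.1)).toRingHom halg
  simp only [map_killVar] at key
  refine (key ?_).congr fun j _ => ?_
  · refine hspecial.congr fun j _ => ?_
    rw [map_formOfCoeffs_of_isHomogeneous (p := prodForm Finset.univ c (T j))
      (hTcard j ▸ prodForm_isHomogeneous _ _ _) fun μ => aeval_X _ _, killVar_prodForm]
  · rw [map_formOfCoeffs_of_isHomogeneous (hf j) fun μ => aeval_X _ _]

end generic

section standardMonomials

theorem expDeg_eq_degree {n : ℕ} (μ : Fin n →₀ ℕ) : expDeg μ = μ.degree := rfl

theorem IsGenericSeq.algebraicIndependent_coeff {F K : Type*} [CommRing F] [CommRing K]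
    [Algebra F K] {n r : ℕ} {d : Fin r → ℕ} {f : Fin r → MvPolynomial (Fin n) K}
    (hf : IsGenericSeq F d f) :
    AlgebraicIndependent F
      fun p : Σ j : Fin r, { μ : Fin n →₀ ℕ // μ.degree = d j } => (f p.1).coeff p.2.1 :=
  hf.2

variable {n : ℕ} {K : Type*} [CommRing K]

theorem monomial_mem_initialIdeal {I : Ideal (MvPolynomial (Fin n) K)}
    {p : MvPolynomial (Fin n) K} {μ : Fin n →₀ ℕ} (hp : p ∈ I) (hμ : IsLeadExp p μ) :
    monomial μ (1 : K) ∈ initialIdeal I :=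
  Ideal.subset_span ⟨p, hp, fun h => by simpa [h] using hμ.1, μ, hμ, rfl⟩

theorem exists_isLeadExp_of_monomial_mem_initialIdeal [Nontrivial K]
    {I : Ideal (MvPolynomial (Fin n) K)} {ν : Fin n →₀ ℕ}
    (h : monomial ν (1 : K) ∈ initialIdeal I) : ∃ p ∈ I, ∃ μ ≤ ν, IsLeadExp p μ := by
  have hset : { m | ∃ p ∈ I, p ≠ 0 ∧ ∃ μ, IsLeadExp p μ ∧ m = monomial μ (1 : K) } =
      (fun μ => monomial μ (1 : K)) '' { μ | ∃ p ∈ I, IsLeadExp p μ } := by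
    ext m
    constructor
    · rintro ⟨p, hp, -, μ, hμ, rfl⟩
      exact ⟨μ, ⟨p, hp, hμ⟩, rfl⟩
    · rintro ⟨μ, ⟨p, hp, hμ⟩, rfl⟩
      exact ⟨p, hp, fun h => by simpa [h] using hμ.1, μ, hμ, rfl⟩
  rw [initialIdeal, hset, mem_ideal_span_monomial_image] at h
  obtain ⟨μ, ⟨p, hp, hμ⟩, hle⟩ := h ν (by simp)
  exact ⟨p, hp, μ, hle, hμ⟩

theorem monomial_mem_initialIdeal_of_le {I : Ideal (MvPolynomial (Fin n) K)} {μ ν : Fin n →₀ ℕ}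
    (hle : μ ≤ ν) (h : monomial μ (1 : K) ∈ initialIdeal I) :
    monomial ν (1 : K) ∈ initialIdeal I := by
  rw [← tsub_add_cancel_of_le hle, ← one_mul (1 : K), ← monomial_mul]
  exact Ideal.mul_mem_left _ _ h

theorem DrlLT.add_right {a b : Fin n →₀ ℕ} (h : DrlLT a b) (c : Fin n →₀ ℕ) :
    DrlLT (a + c) (b + c) := by
  simp only [DrlLT, expDeg_eq_degree, map_add, Finsupp.add_apply] at h ⊢
  rcases h with h | ⟨h, k, hk, hj⟩
  · exact Or.inl (by omega)
  · exact Or.inr ⟨by omega, k, by omega, fun j hkj => by rw [hj j hkj]⟩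

theorem DrlLT.of_add_right {a b c : Fin n →₀ ℕ} (h : DrlLT (a + c) (b + c)) : DrlLT a b := by
  simp only [DrlLT, expDeg_eq_degree, map_add, Finsupp.add_apply] at h ⊢
  rcases h with h | ⟨h, k, hk, hj⟩
  · exact Or.inl (by omega)
  · exact Or.inr ⟨by omega, k, by omega, fun j hkj => by have := hj j hkj; omega⟩

theorem IsLeadExp.mul_monomial {p : MvPolynomial (Fin n) K} {μ : Fin n →₀ ℕ}
    (h : IsLeadExp p μ) (c : Fin n →₀ ℕ) : IsLeadExp (p * monomial c 1) (μ + c) := by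
  refine ⟨by simpa [mem_support_iff, coeff_mul_monomial] using h.1, fun ν hν hne => ?_⟩
  rw [mem_support_iff, coeff_mul_monomial'] at hν
  have hle : c ≤ ν := by
    by_contra hc
    simp [hc] at hν
  rw [if_pos hle, mul_one] at hν
  rw [← tsub_add_cancel_of_le hle]
  refine (h.2 _ (mem_support_iff.2 hν) fun h' => hne ?_).add_right c
  rw [← h', tsub_add_cancel_of_le hle]

theorem IsLeadExp.of_mul_monomial {p : MvPolynomial (Fin n) K} {μ c : Fin n →₀ ℕ}
    (h : IsLeadExp (p * monomial c 1) (μ + c)) : IsLeadExp p μ := by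
  refine ⟨by simpa [mem_support_iff, coeff_mul_monomial] using h.1, fun ν hν hne => ?_⟩
  refine (h.2 (ν + c) ?_ fun h' => hne (add_right_cancel h')).of_add_right
  simpa [mem_support_iff, coeff_mul_monomial] using hν

theorem IsLeadExp.homogeneousComponent {p : MvPolynomial (Fin n) K} {μ : Fin n →₀ ℕ}
    (h : IsLeadExp p μ) : IsLeadExp (homogeneousComponent μ.degree p) μ := by
  refine ⟨?_, fun ν hν => h.2 ν ?_⟩
  · simpa [mem_support_iff, coeff_homogeneousComponent] using h.1
  · rw [mem_support_iff, coeff_homogeneousComponent] at hν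
    exact mem_support_iff.2 fun h0 => hν (by simp [h0])

theorem IsLeadExp.X_last_dvd {p : MvPolynomial (Fin n) K} {μ : Fin n →₀ ℕ} {w : Fin n}
    (hw : ∀ j, j ≤ w) (h : IsLeadExp p μ) (hp : p.IsHomogeneous μ.degree) (hμ : μ w ≠ 0) :
    X w ∣ p := by
  rw [X_dvd_iff_modMonomial_eq_zero]
  ext ν
  rw [coeff_zero]
  by_cases hle : Finsupp.single w 1 ≤ ν
  · exact coeff_modMonomial_of_le _ hle
  rw [coeff_modMonomial_of_not_le _ hle]
  by_contra hν
  have hνw : ν w = 0 := by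
    by_contra h0
    exact hle (Finsupp.single_le_iff.2 (Nat.one_le_iff_ne_zero.2 h0))
  have hdeg : ν.degree = μ.degree := by
    by_contra h0
    exact hν (hp.coeff_eq_zero h0)
  rcases h.2 ν (mem_support_iff.2 hν) (by rintro rfl; exact hμ hνw) with h' | ⟨-, k, hk, hj⟩
  · exact h'.ne hdeg
  · rcases (hw k).lt_or_eq with hkw | rfl
    · exact hμ ((hj w hkw).symm.trans hνw)
    · omega

theorem monomial_add_single_notMem_initialIdeal [Nontrivial K]
    {I : Ideal (MvPolynomial (Fin n) K)}
    (hI : ∀ p ∈ I, ∀ a, homogeneousComponent a p ∈ I) {w : Fin n} (hw : ∀ j, j ≤ w)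
    {ν : Fin n →₀ ℕ}
    (hcolon : ∀ p : MvPolynomial (Fin n) K, p.IsHomogeneous ν.degree → X w * p ∈ I → p ∈ I)
    (hν : monomial ν (1 : K) ∉ initialIdeal I) :
    monomial (ν + Finsupp.single w 1) (1 : K) ∉ initialIdeal I := by
  intro h
  obtain ⟨p, hp, μ, hle, hlead⟩ := exists_isLeadExp_of_monomial_mem_initialIdeal h
  have hle' : Finsupp.single w 1 ≤ ν + Finsupp.single w 1 := le_add_self
  set q := homogeneousComponent μ.degree p *
    monomial (ν + Finsupp.single w 1 - μ) (1 : K) with hq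
  have hqI : q ∈ I := Ideal.mul_mem_right _ _ (hI p hp _)
  have hqlead : IsLeadExp q (ν + Finsupp.single w 1) := by
    have := hlead.homogeneousComponent.mul_monomial (ν + Finsupp.single w 1 - μ)
    rwa [add_tsub_cancel_of_le hle] at this
  have hqhom : q.IsHomogeneous (ν + Finsupp.single w 1).degree := by
    have := (homogeneousComponent_isHomogeneous μ.degree p).mul
      (isHomogeneous_monomial (1 : K) (rfl : (ν + Finsupp.single w 1 - μ).degree = _))
    rwa [← map_add, add_tsub_cancel_of_le hle] at this
  obtain ⟨r, hr⟩ := hqlead.X_last_dvd hw hqhom (by simp)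
  have hrlead : IsLeadExp r ν := by
    refine IsLeadExp.of_mul_monomial (c := Finsupp.single w 1) ?_
    rwa [mul_comm, ← X, ← hr]
  have hrhom : r.IsHomogeneous ν.degree := by
    intro μ hμ
    have := hqhom (d := μ + Finsupp.single w 1) (by rwa [hr, mul_comm, coeff_mul_X])
    rw [map_add, map_add, Finsupp.weight_single, Finsupp.degree_single] at this
    simpa using this
  exact hν (monomial_mem_initialIdeal (hcolon r hrhom (hr ▸ hqI)) hrlead)

theorem stdMon_eq_union [Nontrivial K]
    {I : Ideal (MvPolynomial (Fin n) K)}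
    (hI : ∀ p ∈ I, ∀ a, homogeneousComponent a p ∈ I) {w : Fin n} (hw : ∀ j, j ≤ w)
    {i : ℕ} (hi : 1 ≤ i)
    (hcolon : ∀ p : MvPolynomial (Fin n) K, p.IsHomogeneous (i - 1) → X w * p ∈ I → p ∈ I) :
    stdMon I i = { μ ∈ stdMon I i | μ w = 0 } ∪
      (fun ν => ν + Finsupp.single w 1) '' stdMon I (i - 1) := by
  ext μ
  constructor
  · intro hμ
    rcases eq_or_ne (μ w) 0 with h0 | h0
    · exact Or.inl ⟨hμ, h0⟩
    have hle : Finsupp.single w 1 ≤ μ := Finsupp.single_le_iff.2 (Nat.one_le_iff_ne_zero.2 h0)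
    have hdeg : (μ - Finsupp.single w 1).degree + 1 = i := by
      have := congrArg Finsupp.degree (tsub_add_cancel_of_le hle)
      rw [map_add, Finsupp.degree_single] at this
      exact this.trans hμ.1
    refine Or.inr ⟨μ - Finsupp.single w 1, ⟨?_, fun h => hμ.2 ?_⟩, tsub_add_cancel_of_le hle⟩
    · rw [expDeg_eq_degree]
      omega
    · exact monomial_mem_initialIdeal_of_le tsub_le_self h
  · rintro (h | ⟨ν, ⟨hdeg, hν⟩, rfl⟩)
    · exact h.1
    rw [expDeg_eq_degree] at hdeg
    refine ⟨?_, monomial_add_single_notMem_initialIdeal hI hw (hdeg ▸ hcolon) hν⟩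
    rw [expDeg_eq_degree, map_add, Finsupp.degree_single]
    omega

end standardMonomials

/-- for `1 ≤ i ≤ σ`, `B_i = B̃_i^0 ∪ x_n·B_{i−1}` for the standard monomials of a
generic ideal of type `(n; d_1,…,d_n)`. -/
theorem stmt1 {F K : Type*} [Field F] [Field K] [Algebra F K] [Infinite K]
    {n : ℕ} (hn : 0 < n) (d : Fin n → ℕ) (hd : ∀ i, 1 ≤ d i)
    (f : Fin n → MvPolynomial (Fin n) K) (hf : IsGenericSeq F d f)
    (J : Ideal (MvPolynomial (Fin n) K)) (hJ : J = Ideal.span (Set.range f))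
    (δ δs σ : ℕ) (hδ : δ = (∑ j, d j) - n)
    (hδs : δs = (∑ j ∈ Finset.univ.filter (fun j : Fin n => (j : ℕ) < n - 1), d j) - (n - 1))
    (hσ : σ = min δs (δ / 2))
    (i : ℕ) (hi1 : 1 ≤ i) (hiσ : i ≤ σ) :
    stdMon J i =
      { μ ∈ stdMon J i | μ ⟨n - 1, by omega⟩ = 0 } ∪
        (fun ν => ν + Finsupp.single (⟨n - 1, by omega⟩ : Fin n) 1) '' stdMon J (i - 1) := by
  have hwlast (j : Fin n) : j ≤ ⟨n - 1, by omega⟩ := Fin.le_def.2 (by have := j.2; simp; omega)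
  have hspan : Set.range f = f '' ((Finset.univ : Finset (Fin n)) : Set (Fin n)) := by simp
  refine stdMon_eq_union (fun p hp a => ?_) hwlast hi1 fun p hp hmem => ?_
  · rw [hJ, hspan] at hp ⊢
    have := shiftComponent_mem_span (fun j _ => hf.1 j) a 0 hp
    simpa [shiftComponent] using this
  · rw [hJ, hspan] at hmem ⊢
    have hsum : n ≤ ∑ j, d j := by
      simpa using Finset.card_nsmul_le_sum Finset.univ d 1 fun j _ => hd j
    refine KoszulSyzygies.mem_of_X_mul_mem (i := i) (fun j _ => hf.1 j)
      (koszulSyzygies_killVar_of_algebraicIndependent hf.1 hf.algebraicIndependent_coeff rfl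
        ⟨n - 1, by omega⟩ ?_) (shiftComponent_of_isHomogeneous (by omega) hp) hmem
    rw [Fintype.card_fin]
    omega
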